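/- arXiv:1605.07757 — 3 statements merged into one kernel-verified Lean document; each statement's English description precedes it below -/
import Mathlib

section
/- The bilinear form ⟨u,v⟩ := ψ(uv) on A^{k,s}(a,c) is symmetric, associative (⟨uv,w⟩ = ⟨u,vw⟩ for all u,v,w) and nondegenerate; in particular A^{k,s}(a,c) is a symmetric K-algebra. -/
namespace QT

/-- The generators of the free algebra: the two vertex idempotents `e1, e2`,
the loops `al` (α at vertex 1) and `et` (η at vertex 2), and the arrows
`be` (β : 1 → 2) and `ga` (γ : 2 → 1). -/
inductive Gen : Type
  | e1 : Gen
  | e2 : Gen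
  | al : Gen
  | be : Gen
  | ga : Gen
  | et : Gen

open Gen

/-- Generators as elements of the free algebra. -/
noncomputable def gen (K : Type) [Field K] (g : Gen) : FreeAlgebra K Gen :=
  FreeAlgebra.ι K g

/-- The defining relations of the algebra `A^{k,s}(a,c)`: the path-algebra
relations for the quiver with two vertices, loops α, η and arrows β, γ
(paths composed left to right), together with the relations
βη = (αβγ)^{k−1}αβ, ηγ = (γαβ)^{k−1}γα, α² = a(βγα)^{k−1}βγ + c(βγα)^k,
γβ = η^{s−1}, α²β = 0, γα² = 0. -/
inductive Rel (K : Type) [Field K] (k s : ℕ) (a c : K) :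
    FreeAlgebra K Gen → FreeAlgebra K Gen → Prop
  | idem1 : Rel K k s a c (gen K e1 * gen K e1) (gen K e1)
  | idem2 : Rel K k s a c (gen K e2 * gen K e2) (gen K e2)
  | orth12 : Rel K k s a c (gen K e1 * gen K e2) 0
  | orth21 : Rel K k s a c (gen K e2 * gen K e1) 0
  | sum_idem : Rel K k s a c (gen K e1 + gen K e2) 1
  | al_left : Rel K k s a c (gen K e1 * gen K al) (gen K al)
  | al_right : Rel K k s a c (gen K al * gen K e1) (gen K al)
  | be_left : Rel K k s a c (gen K e1 * gen K be) (gen K be)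
  | be_right : Rel K k s a c (gen K be * gen K e2) (gen K be)
  | ga_left : Rel K k s a c (gen K e2 * gen K ga) (gen K ga)
  | ga_right : Rel K k s a c (gen K ga * gen K e1) (gen K ga)
  | et_left : Rel K k s a c (gen K e2 * gen K et) (gen K et)
  | et_right : Rel K k s a c (gen K et * gen K e2) (gen K et)
  | rel_beta_eta : Rel K k s a c (gen K be * gen K et)
      ((gen K al * gen K be * gen K ga) ^ (k - 1) * (gen K al * gen K be))
  | rel_eta_gamma : Rel K k s a c (gen K et * gen K ga)
      ((gen K ga * gen K al * gen K be) ^ (k - 1) * (gen K ga * gen K al))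
  | rel_alpha_sq : Rel K k s a c (gen K al * gen K al)
      (a • ((gen K be * gen K ga * gen K al) ^ (k - 1) * (gen K be * gen K ga)) +
        c • (gen K be * gen K ga * gen K al) ^ k)
  | rel_gamma_beta : Rel K k s a c (gen K ga * gen K be) ((gen K et) ^ (s - 1))
  | rel_alpha_sq_beta : Rel K k s a c (gen K al * gen K al * gen K be) 0
  | rel_gamma_alpha_sq : Rel K k s a c (gen K ga * (gen K al * gen K al)) 0

/-- The algebra `A^{k,s}(a,c)` of quaternion type with two simple modules. -/
abbrev Aa (K : Type) [Field K] (k s : ℕ) (a c : K) : Type :=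
  RingQuot (Rel K k s a c)

variable (K : Type) [Field K] (k s : ℕ) (a c : K)

/-- The idempotent e₁ in `A^{k,s}(a,c)`. -/
noncomputable def E1 : Aa K k s a c := RingQuot.mkAlgHom K (Rel K k s a c) (gen K e1)
/-- The idempotent e₂ in `A^{k,s}(a,c)`. -/
noncomputable def E2 : Aa K k s a c := RingQuot.mkAlgHom K (Rel K k s a c) (gen K e2)
/-- The loop α in `A^{k,s}(a,c)`. -/
noncomputable def Al : Aa K k s a c := RingQuot.mkAlgHom K (Rel K k s a c) (gen K al)
/-- The arrow β in `A^{k,s}(a,c)`. -/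
noncomputable def Be : Aa K k s a c := RingQuot.mkAlgHom K (Rel K k s a c) (gen K be)
/-- The arrow γ in `A^{k,s}(a,c)`. -/
noncomputable def Ga : Aa K k s a c := RingQuot.mkAlgHom K (Rel K k s a c) (gen K ga)
/-- The loop η in `A^{k,s}(a,c)`. -/
noncomputable def Et : Aa K k s a c := RingQuot.mkAlgHom K (Rel K k s a c) (gen K et)

/-- The commutator subspace [A,A]: the K-subspace spanned by all commutators. -/
noncomputable def comm : Submodule K (Aa K k s a c) :=
  Submodule.span K {z : Aa K k s a c | ∃ u v : Aa K k s a c, z = u * v - v * u}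

/-- Index type for the basis B = B₁ ∪ B₂ ∪ B₃ ∪ B₄ of `A^{k,s}(a,c)`. -/
abbrev BIdx (k s : ℕ) : Type :=
  ((Fin k ⊕ Fin k) ⊕ (Fin (k - 1) ⊕ Fin (k + 1))) ⊕
    ((Fin (s + 1) ⊕ Fin (k - 1)) ⊕ ((Fin k ⊕ Fin k) ⊕ (Fin k ⊕ Fin k)))

/-- The family of elements of `A^{k,s}(a,c)` given by
B₁ = {α(βγα)^n, (βγα)^nβγ : 0 ≤ n ≤ k−1} ∪ {(βγα)^m : 1 ≤ m ≤ k−1} ∪ {(αβγ)^ℓ : 0 ≤ ℓ ≤ k},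
B₂ = {η^t : 0 ≤ t ≤ s} ∪ {(γαβ)^m : 1 ≤ m ≤ k−1},
B₃ = {(βγα)^nβ, α(βγα)^nβ : 0 ≤ n ≤ k−1},
B₄ = {(γαβ)^nγ, (γαβ)^nγα : 0 ≤ n ≤ k−1}. -/
noncomputable def bVec : BIdx k s → Aa K k s a c := fun i =>
  let α := Al K k s a c
  let β := Be K k s a c
  let γ := Ga K k s a c
  let η := Et K k s a c
  match i with
  | .inl (.inl (.inl n)) => α * (β * γ * α) ^ (n : ℕ)
  | .inl (.inl (.inr n)) => (β * γ * α) ^ (n : ℕ) * (β * γ)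
  | .inl (.inr (.inl m)) => (β * γ * α) ^ ((m : ℕ) + 1)
  | .inl (.inr (.inr l)) => (α * β * γ) ^ (l : ℕ)
  | .inr (.inl (.inl t)) => η ^ (t : ℕ)
  | .inr (.inl (.inr m)) => (γ * α * β) ^ ((m : ℕ) + 1)
  | .inr (.inr (.inl (.inl n))) => (β * γ * α) ^ (n : ℕ) * β
  | .inr (.inr (.inl (.inr n))) => α * (β * γ * α) ^ (n : ℕ) * β
  | .inr (.inr (.inr (.inl n))) => (γ * α * β) ^ (n : ℕ) * γ
  | .inr (.inr (.inr (.inr n))) => (γ * α * β) ^ (n : ℕ) * (γ * α)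

/-- `ψ` is the linear form on `A^{k,s}(a,c)` sending η^s and (αβγ)^k to 1 and every
other element of the basis B to 0. -/
noncomputable def IsPsi (ψ : Aa K k s a c →ₗ[K] K) : Prop :=
  ψ ((Et K k s a c) ^ s) = 1 ∧
  ψ ((Al K k s a c * Be K k s a c * Ga K k s a c) ^ k) = 1 ∧
  ∀ i : BIdx k s, bVec K k s a c i ≠ (Et K k s a c) ^ s →
    bVec K k s a c i ≠ (Al K k s a c * Be K k s a c * Ga K k s a c) ^ k →
    ψ (bVec K k s a c i) = 0

/-- The set T₁(A) = {x ∈ A : x² ∈ [A,A]} (characteristic 2). -/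
noncomputable def T1 : Set (Aa K k s a c) :=
  {z : Aa K k s a c | z ^ 2 ∈ comm K k s a c}

/-- The orthogonal space T₁(A)^⊥ of T₁(A) with respect to the symmetrising form
⟨u,v⟩ = ψ(uv): the space of all z with ψ(z·m) = 0 for all m ∈ T₁(A). -/
noncomputable def perp (ψ : Aa K k s a c →ₗ[K] K) : Submodule K (Aa K k s a c) :=
  ⨅ m ∈ T1 K k s a c, LinearMap.ker (ψ ∘ₗ LinearMap.mulRight K m)

end QT

structure Dat (A : Type) where
  e1 : A
  e2 : A
  al : A
  be : A
  ga : A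
  et : A

namespace Dat

set_option linter.unusedSectionVars false

variable {K A : Type} [Field K] [Ring A] [Algebra K A]

/-- cyclic letter -/
def L (d : Dat A) (n : ℕ) : A := if n % 3 = 0 then d.al else if n % 3 = 1 then d.be else d.ga

/-- source idempotent -/
def e (d : Dat A) (n : ℕ) : A := if n % 3 = 2 then d.e2 else d.e1

/-- cyclic word -/
def W (d : Dat A) : ℕ → ℕ → A
  | _, 0 => 1
  | p, l + 1 => d.L p * W d (p + 1) l

structure Ok (K : Type) [Field K] [Algebra K A] (d : Dat A) (k s : ℕ) (a c : K) : Prop where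
  hk : 1 ≤ k
  hs : 3 ≤ s
  i1 : d.e1 * d.e1 = d.e1
  i2 : d.e2 * d.e2 = d.e2
  o12 : d.e1 * d.e2 = 0
  o21 : d.e2 * d.e1 = 0
  sum : d.e1 + d.e2 = 1
  all : d.e1 * d.al = d.al
  alr : d.al * d.e1 = d.al
  bel : d.e1 * d.be = d.be
  ber : d.be * d.e2 = d.be
  gal : d.e2 * d.ga = d.ga
  gar : d.ga * d.e1 = d.ga
  etl : d.e2 * d.et = d.et
  etr : d.et * d.e2 = d.et
  rbe : d.be * d.et = d.W 0 (3 * k - 1)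
  reg : d.et * d.ga = d.W 2 (3 * k - 1)
  raa : d.al * d.al = a • d.W 1 (3 * k - 1) + c • d.W 1 (3 * k)
  rgb : d.ga * d.be = d.et ^ (s - 1)
  raab : d.al * d.al * d.be = 0
  rgaa : d.ga * (d.al * d.al) = 0
  gen : ∀ S : Submodule K A, 1 ∈ S → (∀ u ∈ S, u * d.e1 ∈ S ∧ u * d.e2 ∈ S ∧ u * d.al ∈ S ∧
    u * d.be ∈ S ∧ u * d.ga ∈ S ∧ u * d.et ∈ S) → ∀ u, u ∈ S

variable (d : Dat A)

theorem L_congr {p q : ℕ} (h : p % 3 = q % 3) : d.L p = d.L q := by simp [L, h]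
theorem L0 {p : ℕ} (h : p % 3 = 0) : d.L p = d.al := by simp [L, h]
theorem L1 {p : ℕ} (h : p % 3 = 1) : d.L p = d.be := by simp [L, h]
theorem L2 {p : ℕ} (h : p % 3 = 2) : d.L p = d.ga := by simp [L, h]

theorem W_congr {p q : ℕ} (h : p % 3 = q % 3) (l : ℕ) : d.W p l = d.W q l := by
  induction l generalizing p q with
  | zero => rfl
  | succ l ih => rw [W, W, d.L_congr h, ih (p := p + 1) (q := q + 1) (by omega)]

theorem W_add (p l m : ℕ) : d.W p (l + m) = d.W p l * d.W (p + l) m := by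
  induction l generalizing p with
  | zero => simp [W]
  | succ l ih =>
    rw [show l + 1 + m = (l + m) + 1 by omega, W, W, ih, mul_assoc,
      show p + 1 + l = p + (l + 1) by omega]

theorem W_split {p l : ℕ} (m n : ℕ) (h : l = m + n) : d.W p l = d.W p m * d.W (p + m) n := by
  rw [h, W_add]

theorem W1 (p : ℕ) : d.W p 1 = d.L p := by simp [W]
theorem W2 (p : ℕ) : d.W p 2 = d.L p * d.L (p + 1) := by simp [W]
theorem W3 (p : ℕ) : d.W p 3 = d.L p * d.L (p + 1) * d.L (p + 2) := by simp [W, mul_assoc]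

theorem W_last {p l : ℕ} (h : 1 ≤ l) : d.W p l = d.W p (l - 1) * d.L (p + l - 1) := by
  rw [d.W_split (l - 1) 1 (by omega), W1, show p + (l - 1) = p + l - 1 by omega]

theorem W_first {p l : ℕ} (h : 1 ≤ l) : d.W p l = d.L p * d.W (p + 1) (l - 1) := by
  rw [d.W_split 1 (l - 1) (by omega), W1]

theorem W_pow (p n : ℕ) : d.W p (3 * n) = (d.W p 3) ^ n := by
  induction n with
  | zero => simp [W]
  | succ n ih =>
    rw [show 3 * (n + 1) = 3 * n + 3 by omega, W_add, ih, d.W_congr (p := p + 3 * n) (q := p) (by omega), pow_succ]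

theorem m3 (n : ℕ) : n % 3 = 0 ∨ n % 3 = 1 ∨ n % 3 = 2 := by omega

namespace Ok
variable {d} {k s : ℕ} {a c : K} (H : d.Ok K k s a c)
include H

theorem z1 (x y : A) (hx : x * d.e1 = x) (hy : d.e2 * y = y) : x * y = 0 := by
  rw [← hx, ← hy, mul_assoc, ← mul_assoc d.e1, H.o12]; simp
theorem z2 (x y : A) (hx : x * d.e2 = x) (hy : d.e1 * y = y) : x * y = 0 := by
  rw [← hx, ← hy, mul_assoc, ← mul_assoc d.e2, H.o21]; simp

theorem ag : d.al * d.ga = 0 := H.z1 _ _ H.alr H.gal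
theorem aeta : d.al * d.et = 0 := H.z1 _ _ H.alr H.etl
theorem gg : d.ga * d.ga = 0 := H.z1 _ _ H.gar H.gal
theorem geta : d.ga * d.et = 0 := H.z1 _ _ H.gar H.etl
theorem ba : d.be * d.al = 0 := H.z2 _ _ H.ber H.all
theorem bb : d.be * d.be = 0 := H.z2 _ _ H.ber H.bel
theorem etaa : d.et * d.al = 0 := H.z2 _ _ H.etr H.all
theorem etab : d.et * d.be = 0 := H.z2 _ _ H.etr H.bel

theorem abeta : d.al * d.be * d.et = 0 := by
  have := H.hk
  rw [mul_assoc, H.rbe, d.W_split 2 (3 * k - 3) (by omega), W2, d.L0 (by omega), d.L1 (by omega),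
    ← mul_assoc, ← mul_assoc, H.raab, zero_mul]

theorem etaga : d.et * d.ga * d.al = 0 := by
  have := H.hk
  rw [H.reg, d.W_split (3 * k - 3) 2 (by omega), W2, d.L2 (by omega), d.L0 (by omega),
    mul_assoc, mul_assoc, H.rgaa, mul_zero]

theorem bee : d.be * d.et * d.et = 0 := by
  have := H.hk
  rw [H.rbe, d.W_split (3 * k - 3) 2 (by omega), W2, d.L0 (by omega), d.L1 (by omega),
    mul_assoc, H.abeta, mul_zero]

theorem eeg : d.et * (d.et * d.ga) = 0 := by
  have := H.hk
  rw [H.reg, d.W_split 2 (3 * k - 3) (by omega), W2, d.L2 (by omega), d.L0 (by omega),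
    ← mul_assoc, ← mul_assoc, H.etaga, zero_mul]

theorem beepow {t : ℕ} (h : 2 ≤ t) : d.be * d.et ^ t = 0 := by
  obtain ⟨t, rfl⟩ := Nat.exists_eq_add_of_le h
  rw [pow_add, pow_two, ← mul_assoc, ← mul_assoc, H.bee, zero_mul]

theorem egpow {t : ℕ} (h : 2 ≤ t) : d.et ^ t * d.ga = 0 := by
  obtain ⟨t, rfl⟩ := Nat.exists_eq_add_of_le' h
  rw [pow_add, pow_two, mul_assoc, mul_assoc d.et, H.eeg, mul_zero]

theorem bgb : d.be * d.ga * d.be = 0 := by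
  have := H.hs
  rw [mul_assoc, H.rgb, H.beepow (by omega)]

theorem gbg : d.ga * d.be * d.ga = 0 := by
  have := H.hs
  rw [H.rgb, H.egpow (by omega)]

theorem S01 : d.W 0 (3 * k) = d.W 1 (3 * k) := by
  have := H.hk
  rw [d.W_last (p := 0) (by omega), d.W_first (p := 1) (by omega), d.L2 (by omega), d.L1 (by omega),
    ← H.rbe, ← H.reg, mul_assoc]

theorem S2 : d.W 2 (3 * k) = d.et ^ s := by
  have := H.hk
  have := H.hs
  rw [d.W_last (by omega), d.L1 (by omega), ← H.reg, mul_assoc, H.rgb, ← pow_succ',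
    show s - 1 + 1 = s by omega]

theorem tri_r (x q : ℕ) (h : q % 3 ≠ (x + 2) % 3) : d.L x * d.L (x + 1) * d.L q = 0 := by
  rcases m3 x with hx | hx | hx <;> rcases m3 q with hq | hq | hq <;> first
    | (exfalso; omega)
    | skip
  · rw [d.L0 hx, d.L1 (by omega), d.L0 hq, mul_assoc, H.ba, mul_zero]
  · rw [d.L0 hx, d.L1 (by omega), d.L1 hq, mul_assoc, H.bb, mul_zero]
  · rw [d.L1 hx, d.L2 (by omega), d.L1 hq, H.bgb]
  · rw [d.L1 hx, d.L2 (by omega), d.L2 hq, mul_assoc, H.gg, mul_zero]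
  · rw [d.L2 hx, d.L0 (by omega), d.L0 hq, mul_assoc, H.rgaa]
  · rw [d.L2 hx, d.L0 (by omega), d.L2 hq, mul_assoc, H.ag, mul_zero]

theorem tri_l (x q : ℕ) (h : (q + 1) % 3 ≠ x % 3) : d.L q * (d.L x * d.L (x + 1)) = 0 := by
  rw [← mul_assoc]
  rcases m3 x with hx | hx | hx <;> rcases m3 q with hq | hq | hq <;> first
    | (exfalso; omega)
    | skip
  · rw [d.L0 hx, d.L1 (p := x + 1) (by omega), d.L0 hq, H.raab]
  · rw [d.L0 hx, d.L1 hq, H.ba, zero_mul]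
  · rw [d.L1 hx, d.L1 hq, H.bb, zero_mul]
  · rw [d.L1 hx, d.L2 (p := x + 1) (by omega), d.L2 hq, H.gbg]
  · rw [d.L2 hx, d.L0 hq, H.ag, zero_mul]
  · rw [d.L2 hx, d.L2 hq, H.gg, zero_mul]

theorem mis_r {p l q : ℕ} (hl : 2 ≤ l) (h : q % 3 ≠ (p + l) % 3) : d.W p l * d.L q = 0 := by
  rw [d.W_split (l - 2) 2 (by omega), W2, mul_assoc, H.tri_r _ _ (by omega), mul_zero]

theorem mis_l {p l q : ℕ} (hl : 2 ≤ l) (h : (q + 1) % 3 ≠ p % 3) : d.L q * d.W p l = 0 := by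
  rw [d.W_split 2 (l - 2) (by omega), W2, ← mul_assoc, H.tri_l _ _ (by omega), zero_mul]

theorem mis {p l q m : ℕ} (hl : 1 ≤ l) (hm : 1 ≤ m) (hlm : 3 ≤ l + m) (h : q % 3 ≠ (p + l) % 3) :
    d.W p l * d.W q m = 0 := by
  by_cases h2 : 2 ≤ l
  · rw [d.W_first hm, ← mul_assoc, H.mis_r h2 h, zero_mul]
  · obtain rfl : l = 1 := by omega
    rw [W1, H.mis_l (by omega) (by omega)]

theorem SL (p q : ℕ) : d.W p (3 * k) * d.L q = 0 := by
  have := H.hk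
  have := H.hs
  by_cases h : q % 3 = p % 3
  · rcases m3 p with hp | hp | hp
    · rw [d.W_congr (q := 0) (by omega), H.S01, H.mis_r (by omega) (by omega)]
    · rw [d.W_congr (q := 1) (by omega), ← H.S01, H.mis_r (by omega) (by omega)]
    · rw [d.W_congr (q := 2) (by omega), H.S2, d.L2 (by omega), H.egpow (by omega)]
  · exact H.mis_r (by omega) (by omega)

theorem SW (p q : ℕ) {m : ℕ} (hm : 1 ≤ m) : d.W p (3 * k) * d.W q m = 0 := by
  rw [d.W_first hm, ← mul_assoc, H.SL, zero_mul]

theorem Wbig (p : ℕ) {l : ℕ} (hl : 3 * k < l) : d.W p l = 0 := by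
  rw [d.W_split (3 * k) (l - 3 * k) (by omega), H.SW _ _ (by omega)]

theorem Weta {p l : ℕ} (hl : 2 ≤ l) : d.W p l * d.et = 0 := by
  rw [d.W_split (l - 2) 2 (by omega), W2, mul_assoc]
  rcases m3 (p + (l - 2)) with hx | hx | hx
  · rw [d.L0 hx, d.L1 (by omega), H.abeta, mul_zero]
  · rw [d.L1 hx, d.L2 (by omega), mul_assoc d.be, H.geta]; simp
  · rw [d.L2 hx, d.L0 (by omega), mul_assoc d.ga, H.aeta]; simp

theorem etaW {p l : ℕ} (hl : 2 ≤ l) : d.et * d.W p l = 0 := by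
  rw [d.W_split 2 (l - 2) (by omega), W2, ← mul_assoc, ← mul_assoc]
  rcases m3 p with hx | hx | hx
  · rw [d.L0 hx, H.etaa]; simp
  · rw [d.L1 hx, H.etab]; simp
  · rw [d.L2 hx, d.L0 (by omega), H.etaga, zero_mul]

theorem Leta (p : ℕ) : d.L p * d.et = 0 ∨ d.L p * d.et = d.W 0 (3 * k - 1) := by
  rcases m3 p with hx | hx | hx
  · rw [d.L0 hx, H.aeta]; simp
  · rw [d.L1 hx, H.rbe]; simp
  · rw [d.L2 hx, H.geta]; simp

theorem etaL (p : ℕ) : d.et * d.L p = 0 ∨ d.et * d.L p = d.W 2 (3 * k - 1) := by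
  rcases m3 p with hx | hx | hx
  · rw [d.L0 hx, H.etaa]; simp
  · rw [d.L1 hx, H.etab]; simp
  · rw [d.L2 hx, H.reg]; simp

theorem Wetap {p l t : ℕ} (hl : 1 ≤ l) (ht : 1 ≤ t) :
    d.W p l * d.et ^ t = 0 ∨ d.W p l * d.et ^ t = d.W 0 (3 * k - 1) := by
  have := H.hk
  by_cases h2 : 2 ≤ l
  · left
    obtain ⟨t, rfl⟩ := Nat.exists_eq_add_of_le ht
    rw [pow_add, pow_one, ← mul_assoc, H.Weta h2, zero_mul]
  · obtain rfl : l = 1 := by omega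
    obtain ⟨t, rfl⟩ := Nat.exists_eq_add_of_le ht
    rw [pow_add, pow_one, ← mul_assoc, W1]
    rcases H.Leta p with h | h
    · left; rw [h, zero_mul]
    · rcases Nat.eq_zero_or_pos t with rfl | ht
      · right; rw [h]; simp
      · left
        obtain ⟨t, rfl⟩ := Nat.exists_eq_add_of_le ht
        rw [h, pow_add, pow_one, ← mul_assoc, H.Weta (by omega), zero_mul]

theorem etapW {p l t : ℕ} (hl : 1 ≤ l) (ht : 1 ≤ t) :
    d.et ^ t * d.W p l = 0 ∨ d.et ^ t * d.W p l = d.W 2 (3 * k - 1) := by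
  have := H.hk
  by_cases h2 : 2 ≤ l
  · left
    obtain ⟨t, rfl⟩ := Nat.exists_eq_add_of_le' ht
    rw [pow_add, pow_one, mul_assoc, H.etaW h2, mul_zero]
  · obtain rfl : l = 1 := by omega
    obtain ⟨t, rfl⟩ := Nat.exists_eq_add_of_le' ht
    rw [pow_add, pow_one, mul_assoc, W1]
    rcases H.etaL p with h | h
    · left; rw [h, mul_zero]
    · rcases Nat.eq_zero_or_pos t with rfl | ht
      · right; rw [h]; simp
      · left
        obtain ⟨t, rfl⟩ := Nat.exists_eq_add_of_le' ht
        rw [h, pow_add, pow_one, mul_assoc, H.etaW (by omega), mul_zero]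

theorem etabig {t : ℕ} (h : s < t) : d.et ^ t = 0 := by
  have := H.hk
  obtain ⟨t, rfl⟩ := Nat.exists_eq_add_of_le h
  rw [pow_add, pow_succ, ← H.S2, H.Weta (by omega), zero_mul]

theorem LL (p q : ℕ) (h : q % 3 ≠ (p + 1) % 3) : (d.L p * d.L q = 0 ∧ ¬ (p % 3 = 0 ∧ q % 3 = 0)) ∨
    (p % 3 = 0 ∧ q % 3 = 0 ∧ d.L p * d.L q = a • d.W 1 (3 * k - 1) + c • d.W 1 (3 * k)) ∨
    (p % 3 = 2 ∧ q % 3 = 1 ∧ d.L p * d.L q = d.et ^ (s - 1)) := by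
  rcases m3 p with hp | hp | hp <;> rcases m3 q with hq | hq | hq <;> first
    | (exfalso; omega)
    | skip
  · right; left; rw [d.L0 hp, d.L0 hq]; exact ⟨hp, hq, H.raa⟩
  · left; rw [d.L0 hp, d.L2 hq, H.ag]; exact ⟨rfl, by omega⟩
  · left; rw [d.L1 hp, d.L0 hq, H.ba]; exact ⟨rfl, by omega⟩
  · left; rw [d.L1 hp, d.L1 hq, H.bb]; exact ⟨rfl, by omega⟩
  · right; right; rw [d.L2 hp, d.L1 hq]; exact ⟨hp, hq, H.rgb⟩
  · left; rw [d.L2 hp, d.L2 hq, H.gg]; exact ⟨rfl, by omega⟩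

theorem ee (p : ℕ) : d.e p * d.e p = d.e p := by
  unfold e; split_ifs
  · exact H.i2
  · exact H.i1

theorem eL (p : ℕ) : d.e p * d.L p = d.L p := by
  rcases m3 p with hp | hp | hp
  · simp [e, L, hp, H.all]
  · simp [e, L, hp, H.bel]
  · simp [e, L, hp, H.gal]

theorem Le (p : ℕ) : d.L p * d.e (p + 1) = d.L p := by
  rcases m3 p with hp | hp | hp
  · simp [e, L, hp, H.alr, show ¬ (p + 1) % 3 = 2 by omega]
  · simp [e, L, hp, H.ber, show (p + 1) % 3 = 2 by omega]
  · simp [e, L, hp, H.gar, show ¬ (p + 1) % 3 = 2 by omega]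

theorem eW {p l : ℕ} (hl : 1 ≤ l) : d.e p * d.W p l = d.W p l := by
  rw [d.W_first hl, ← mul_assoc, H.eL]

theorem We {p l : ℕ} (hl : 1 ≤ l) : d.W p l * d.e (p + l) = d.W p l := by
  have := H.Le (p + l - 1)
  rw [show p + l - 1 + 1 = p + l by omega] at this
  rw [d.W_last hl, mul_assoc, this]

theorem e1W {p l : ℕ} (hl : 1 ≤ l) : d.e1 * d.W p l = if p % 3 = 2 then 0 else d.W p l := by
  rw [← H.eW hl, ← mul_assoc]; unfold e; split_ifs <;> simp [H.o12, H.i1]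
theorem e2W {p l : ℕ} (hl : 1 ≤ l) : d.e2 * d.W p l = if p % 3 = 2 then d.W p l else 0 := by
  rw [← H.eW hl, ← mul_assoc]; unfold e; split_ifs <;> simp [H.o21, H.i2]
theorem We1 {p l : ℕ} (hl : 1 ≤ l) : d.W p l * d.e1 = if (p + l) % 3 = 2 then 0 else d.W p l := by
  rw [← H.We hl, mul_assoc]; unfold e; split_ifs <;> simp [H.o21, H.i1]
theorem We2 {p l : ℕ} (hl : 1 ≤ l) : d.W p l * d.e2 = if (p + l) % 3 = 2 then d.W p l else 0 := by
  rw [← H.We hl, mul_assoc]; unfold e; split_ifs <;> simp [H.o12, H.i2]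

theorem ep1 {t : ℕ} (ht : 1 ≤ t) : d.et ^ t * d.e1 = 0 := by
  obtain ⟨t, rfl⟩ := Nat.exists_eq_add_of_le' ht
  rw [pow_succ, mul_assoc, ← H.etr, mul_assoc, H.o21]; simp
theorem ep2 {t : ℕ} (ht : 1 ≤ t) : d.et ^ t * d.e2 = d.et ^ t := by
  obtain ⟨t, rfl⟩ := Nat.exists_eq_add_of_le' ht
  rw [pow_succ, mul_assoc, H.etr]
theorem e1p {t : ℕ} (ht : 1 ≤ t) : d.e1 * d.et ^ t = 0 := by
  obtain ⟨t, rfl⟩ := Nat.exists_eq_add_of_le' ht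
  rw [pow_succ', ← H.etl, ← mul_assoc, ← mul_assoc, H.o12]; simp
theorem e2p {t : ℕ} (ht : 1 ≤ t) : d.e2 * d.et ^ t = d.et ^ t := by
  obtain ⟨t, rfl⟩ := Nat.exists_eq_add_of_le' ht
  rw [pow_succ', ← mul_assoc, H.etl]

end Ok

/-- indices of the monomial basis -/
inductive I (k s : ℕ) : Type
  | e1 : I k s
  | e2 : I k s
  | s1 : I k s
  | s2 : I k s
  | et (t : ℕ) (h1 : 1 ≤ t) (h2 : t < s) : I k s
  | w (p l : ℕ) (hp : p < 3) (h1 : 1 ≤ l) (h2 : l < 3 * k) : I k s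

def b (d : Dat A) (k s : ℕ) : I k s → A
  | .e1 => d.e1
  | .e2 => d.e2
  | .s1 => d.W 0 (3 * k)
  | .s2 => d.et ^ s
  | .et t _ _ => d.et ^ t
  | .w p l _ _ _ => d.W p l

namespace Ok
variable {d} {k s : ℕ} {a c : K} (H : d.Ok K k s a c)
include H

theorem memW (p : ℕ) {l : ℕ} (hl : 1 ≤ l) :
    d.W p l ∈ Submodule.span K (Set.range (d.b k s)) := by
  rw [d.W_congr (q := p % 3) (by omega)]
  rcases lt_trichotomy l (3 * k) with h | h | h
  · exact Submodule.subset_span ⟨.w (p % 3) l (by omega) hl h, rfl⟩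
  · subst h
    rcases m3 p with hp | hp | hp <;> rw [hp]
    · exact Submodule.subset_span ⟨.s1, rfl⟩
    · rw [← H.S01]; exact Submodule.subset_span ⟨.s1, rfl⟩
    · rw [H.S2]; exact Submodule.subset_span ⟨.s2, rfl⟩
  · rw [H.Wbig _ h]; exact zero_mem _

theorem memE {t : ℕ} (ht : 1 ≤ t) :
    d.et ^ t ∈ Submodule.span K (Set.range (d.b k s)) := by
  rcases lt_trichotomy t s with h | h | h
  · exact Submodule.subset_span ⟨.et t ht h, rfl⟩
  · subst h
    exact Submodule.subset_span ⟨.s2, rfl⟩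
  · rw [H.etabig h]; exact zero_mem _

theorem memWL (p q : ℕ) {l : ℕ} (hl : 1 ≤ l) :
    d.W p l * d.L q ∈ Submodule.span K (Set.range (d.b k s)) := by
  have := H.hk
  have := H.hs
  by_cases h : q % 3 = (p + l) % 3
  · have := H.memW p (l := l + 1) (by omega)
    rwa [W_add, W1, d.L_congr h.symm] at this
  · by_cases h2 : 2 ≤ l
    · rw [H.mis_r h2 h]; exact zero_mem _
    · obtain rfl : l = 1 := by omega
      rw [W1]
      rcases H.LL p q h with ⟨h, -⟩ | ⟨-, -, h⟩ | ⟨-, -, h⟩ <;> rw [h]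
      · exact zero_mem _
      · exact add_mem (Submodule.smul_mem _ _ (H.memW _ (by omega)))
          (Submodule.smul_mem _ _ (H.memW _ (by omega)))
      · exact H.memE (by omega)

theorem memEL (q : ℕ) {t : ℕ} (ht : 1 ≤ t) :
    d.et ^ t * d.L q ∈ Submodule.span K (Set.range (d.b k s)) := by
  have := H.hk
  rw [← W1]
  rcases H.etapW (p := q) (l := 1) (by omega) ht with h | h <;> rw [h]
  · exact zero_mem _
  · exact H.memW _ (by omega)

theorem memWE (p : ℕ) {l : ℕ} (hl : 1 ≤ l) :
    d.W p l * d.et ∈ Submodule.span K (Set.range (d.b k s)) := by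
  have := H.hk
  rw [← pow_one d.et]
  rcases H.Wetap (p := p) (t := 1) hl (by omega) with h | h <;> rw [h]
  · exact zero_mem _
  · exact H.memW _ (by omega)

theorem La : d.L 0 = d.al := d.L0 rfl
theorem Lb : d.L 1 = d.be := d.L1 rfl
theorem Lg : d.L 2 = d.ga := d.L2 rfl

theorem stepW (p : ℕ) {l : ℕ} (hl : 1 ≤ l) :
    let S := Submodule.span K (Set.range (d.b k s)); let u := d.W p l
    u * d.e1 ∈ S ∧ u * d.e2 ∈ S ∧ u * d.al ∈ S ∧ u * d.be ∈ S ∧ u * d.ga ∈ S ∧ u * d.et ∈ S := by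
  refine ⟨?_, ?_, ?_, ?_, ?_, H.memWE p hl⟩
  · rw [H.We1 hl]; split_ifs
    · exact zero_mem _
    · exact H.memW p hl
  · rw [H.We2 hl]; split_ifs
    · exact H.memW p hl
    · exact zero_mem _
  · rw [← H.La]; exact H.memWL p _ hl
  · rw [← H.Lb]; exact H.memWL p _ hl
  · rw [← H.Lg]; exact H.memWL p _ hl

theorem stepE {t : ℕ} (ht : 1 ≤ t) :
    let S := Submodule.span K (Set.range (d.b k s)); let u := d.et ^ t
    u * d.e1 ∈ S ∧ u * d.e2 ∈ S ∧ u * d.al ∈ S ∧ u * d.be ∈ S ∧ u * d.ga ∈ S ∧ u * d.et ∈ S := by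
  refine ⟨?_, ?_, ?_, ?_, ?_, ?_⟩
  · rw [H.ep1 ht]; exact zero_mem _
  · rw [H.ep2 ht]; exact H.memE ht
  · rw [← H.La]; exact H.memEL _ ht
  · rw [← H.Lb]; exact H.memEL _ ht
  · rw [← H.Lg]; exact H.memEL _ ht
  · rw [← pow_succ]; exact H.memE (by omega)

theorem stepe (i : I k s) :
    let S := Submodule.span K (Set.range (d.b k s)); let u := d.b k s i
    u * d.e1 ∈ S ∧ u * d.e2 ∈ S ∧ u * d.al ∈ S ∧ u * d.be ∈ S ∧ u * d.ga ∈ S ∧ u * d.et ∈ S := by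
  have := H.hk
  have := H.hs
  have ma : d.al ∈ Submodule.span K (Set.range (d.b k s)) := by
    rw [← H.La, ← W1]; exact H.memW _ (by omega)
  have mb : d.be ∈ Submodule.span K (Set.range (d.b k s)) := by
    rw [← H.Lb, ← W1]; exact H.memW _ (by omega)
  have mg : d.ga ∈ Submodule.span K (Set.range (d.b k s)) := by
    rw [← H.Lg, ← W1]; exact H.memW _ (by omega)
  have me : d.et ∈ Submodule.span K (Set.range (d.b k s)) := by
    rw [← pow_one d.et]; exact H.memE (by omega)
  have m1 : d.e1 ∈ Submodule.span K (Set.range (d.b k s)) := Submodule.subset_span ⟨.e1, rfl⟩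
  have m2 : d.e2 ∈ Submodule.span K (Set.range (d.b k s)) := Submodule.subset_span ⟨.e2, rfl⟩
  cases i with
  | e1 =>
    refine ⟨?_, ?_, ?_, ?_, ?_, ?_⟩ <;> simp only [b]
    · rwa [H.i1]
    · rw [H.o12]; exact zero_mem _
    · rwa [H.all]
    · rwa [H.bel]
    · rw [H.z1 _ _ H.i1 H.gal]; exact zero_mem _
    · rw [H.z1 _ _ H.i1 H.etl]; exact zero_mem _
  | e2 =>
    refine ⟨?_, ?_, ?_, ?_, ?_, ?_⟩ <;> simp only [b]
    · rw [H.o21]; exact zero_mem _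
    · rwa [H.i2]
    · rw [H.z2 _ _ H.i2 H.all]; exact zero_mem _
    · rw [H.z2 _ _ H.i2 H.bel]; exact zero_mem _
    · rwa [H.gal]
    · rwa [H.etl]
  | s1 => exact H.stepW 0 (by omega)
  | s2 => exact H.stepE (by omega)
  | et t h1 h2 => exact H.stepE h1
  | w p l hp h1 h2 => exact H.stepW p h1

theorem span (u : A) : u ∈ Submodule.span K (Set.range (d.b k s)) := by
  refine H.gen _ ?_ ?_ u
  · rw [← H.sum]
    exact add_mem (Submodule.subset_span ⟨.e1, rfl⟩) (Submodule.subset_span ⟨.e2, rfl⟩)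
  · intro u hu
    induction hu using Submodule.span_induction with
    | mem x hx => obtain ⟨i, rfl⟩ := hx; exact H.stepe i
    | zero => simp
    | add x y _ _ hx hy =>
      simp only [add_mul]
      exact ⟨add_mem hx.1 hy.1, add_mem hx.2.1 hy.2.1, add_mem hx.2.2.1 hy.2.2.1,
        add_mem hx.2.2.2.1 hy.2.2.2.1, add_mem hx.2.2.2.2.1 hy.2.2.2.2.1,
        add_mem hx.2.2.2.2.2 hy.2.2.2.2.2⟩
    | smul r x _ hx =>
      simp only [smul_mul_assoc]
      exact ⟨Submodule.smul_mem _ _ hx.1, Submodule.smul_mem _ _ hx.2.1,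
        Submodule.smul_mem _ _ hx.2.2.1, Submodule.smul_mem _ _ hx.2.2.2.1,
        Submodule.smul_mem _ _ hx.2.2.2.2.1, Submodule.smul_mem _ _ hx.2.2.2.2.2⟩

variable {ψ : A →ₗ[K] K} (hW : ∀ p l, 1 ≤ l → ψ (d.W p l) = if l = 3 * k then 1 else 0)
  (hE : ∀ t, 1 ≤ t → ψ (d.et ^ t) = if t = s then 1 else 0)

include hW in
theorem psiWE {p l t : ℕ} (hl : 1 ≤ l) (ht : 1 ≤ t) : ψ (d.W p l * d.et ^ t) = 0 := by
  have := H.hk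
  rcases H.Wetap (p := p) hl ht with h | h <;> rw [h]
  · simp
  · rw [hW _ _ (by omega), if_neg (by omega)]

include hW in
theorem psiEW {p l t : ℕ} (hl : 1 ≤ l) (ht : 1 ≤ t) : ψ (d.et ^ t * d.W p l) = 0 := by
  have := H.hk
  rcases H.etapW (p := p) hl ht with h | h <;> rw [h]
  · simp
  · rw [hW _ _ (by omega), if_neg (by omega)]

include hW hE in
theorem psiWW {p l q m : ℕ} (hl : 1 ≤ l) (hm : 1 ≤ m) : ψ (d.W p l * d.W q m) =
    (if q % 3 = (p + l) % 3 ∧ l + m = 3 * k then 1 else 0) +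
    (if p % 3 = 0 ∧ q % 3 = 0 ∧ l = 1 ∧ m = 1 then c else 0) := by
  have := H.hk
  have := H.hs
  by_cases h : q % 3 = (p + l) % 3
  · rw [d.W_congr h, ← W_add, hW _ _ (by omega), if_neg (c := _ ∧ _ ∧ _ ∧ _) (by omega)]
    simp [h]
  · rw [if_neg (c := _ ∧ _ = _) (by simp [h]), zero_add]
    by_cases h3 : 3 ≤ l + m
    · rw [H.mis hl hm h3 h, if_neg (by omega), map_zero]
    · obtain rfl : l = 1 := by omega
      obtain rfl : m = 1 := by omega
      rw [W1, W1]
      rcases H.LL p q h with ⟨h, hn⟩ | ⟨hp, hq, h⟩ | ⟨hp, hq, h'⟩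
      · rw [h, map_zero, if_neg]
        exact fun h => hn ⟨h.1, h.2.1⟩
      · rw [h, map_add, map_smul, map_smul, hW _ _ (by omega), hW _ _ (by omega), if_neg (by omega),
          if_pos rfl, if_pos (by omega)]; simp
      · rw [h', hE _ (by omega), if_neg (by omega), if_neg (by omega)]


/-- monomials covering the basis -/
theorem b_cases (i : I k s) : d.b k s i = d.e1 ∨ d.b k s i = d.e2 ∨
    (∃ t, 1 ≤ t ∧ d.b k s i = d.et ^ t) ∨ ∃ p l, 1 ≤ l ∧ d.b k s i = d.W p l := by
  have := H.hk
  have := H.hs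
  cases i with
  | e1 => left; rfl
  | e2 => right; left; rfl
  | s1 => right; right; right; exact ⟨0, 3 * k, by omega, rfl⟩
  | s2 => right; right; left; exact ⟨s, by omega, rfl⟩
  | et t h1 h2 => right; right; left; exact ⟨t, h1, rfl⟩
  | w p l hp h1 h2 => right; right; right; exact ⟨p, l, h1, rfl⟩

include hW in
theorem e1W_comm {p l : ℕ} (hl : 1 ≤ l) : ψ (d.e1 * d.W p l) = ψ (d.W p l * d.e1) := by
  rw [H.e1W hl, H.We1 hl]
  have := hW p l hl
  split_ifs at * <;> first | rfl | omega | simp [this]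

include hW in
theorem e2W_comm {p l : ℕ} (hl : 1 ≤ l) : ψ (d.e2 * d.W p l) = ψ (d.W p l * d.e2) := by
  rw [H.e2W hl, H.We2 hl]
  have := hW p l hl
  split_ifs at * <;> first | rfl | omega | simp [this]

include hW hE in
theorem symm_b (i j : I k s) : ψ (d.b k s i * d.b k s j) = ψ (d.b k s j * d.b k s i) := by
  rcases H.b_cases i with h | h | ⟨t, ht, h⟩ | ⟨p, l, hl, h⟩ <;>
  rcases H.b_cases j with h' | h' | ⟨t', ht', h'⟩ | ⟨p', l', hl', h'⟩ <;> rw [h, h']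
  · rw [H.o12, H.o21]
  · rw [H.e1p ht', H.ep1 ht']
  · rw [H.e1W_comm hW hl']
  · rw [H.o12, H.o21]
  · rw [H.e2p ht', H.ep2 ht']
  · rw [H.e2W_comm hW hl']
  · rw [H.e1p ht, H.ep1 ht]
  · rw [H.e2p ht, H.ep2 ht]
  · rw [← pow_add, ← pow_add, add_comm]
  · rw [H.psiEW hW hl' ht, H.psiWE hW hl' ht]
  · rw [H.e1W_comm hW hl]
  · rw [H.e2W_comm hW hl]
  · rw [H.psiEW hW hl ht', H.psiWE hW hl ht']
  · rw [H.psiWW hW hE hl hl', H.psiWW hW hE hl' hl]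
    congr 1
    · exact if_congr (by omega) rfl rfl
    · exact if_congr (by omega) rfl rfl

include hW hE in
theorem symm (u v : A) : ψ (u * v) = ψ (v * u) := by
  induction H.span u using Submodule.span_induction with
  | mem x hx =>
    obtain ⟨i, rfl⟩ := hx
    induction H.span v using Submodule.span_induction with
    | mem x hx => obtain ⟨j, rfl⟩ := hx; exact H.symm_b hW hE i j
    | zero => simp
    | add x y _ _ hx hy => simp only [add_mul, mul_add, map_add, hx, hy]
    | smul r x _ hx => simp only [smul_mul_assoc, mul_smul_comm, map_smul, hx]
  | zero => simp
  | add x y _ _ hx hy => simp only [add_mul, mul_add, map_add, hx, hy]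
  | smul r x _ hx => simp only [smul_mul_assoc, mul_smul_comm, map_smul, hx]

include hW hE in
theorem nondeg (u : A) (hu : ∀ v, ψ (u * v) = 0) : u = 0 := by
  have hk := H.hk
  have hs := H.hs
  obtain ⟨f, rfl⟩ := (Finsupp.mem_span_range_iff_exists_finsupp).1 (H.span u)
  have key : ∀ (j : I k s) (v : A), ψ (d.b k s j * v) = 1 →
      (∀ i, i ≠ j → f i = 0 ∨ ψ (d.b k s i * v) = 0) → f j = 0 := by
    intro j v hj hi
    have h := hu v
    rw [Finsupp.sum, Finset.sum_mul, map_sum, Finset.sum_eq_single j] at h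
    · simpa [hj] using h
    · intro i _ hij
      rcases hi i hij with h | h <;> simp [h]
    · intro h
      simp [Finsupp.notMem_support_iff.1 h]
  have hS0 := hW 0 (3 * k) (by omega)
  have hS2 := hE s (by omega)
  simp only [if_true] at hS0 hS2
  have fe1 : f .e1 = 0 := by
    refine key _ (d.W 0 (3 * k)) ?_ ?_
    · simp only [b]; rw [H.e1W (by omega), if_neg (by omega), hS0]
    · intro i hi
      right
      cases i with
      | e1 => exact absurd rfl hi
      | e2 => simp only [b]; rw [H.e2W (by omega), if_neg (by omega), map_zero]
      | s1 => simp only [b]; rw [H.SW _ _ (by omega), map_zero]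
      | s2 => simp only [b]; rw [H.psiEW hW (by omega) (by omega)]
      | et t h1 h2 => simp only [b]; rw [H.psiEW hW (by omega) (by omega)]
      | w p l hp h1 h2 =>
        simp only [b]; rw [H.psiWW hW hE h1 (by omega), if_neg (by omega), if_neg (by omega), add_zero]
  have fe2 : f .e2 = 0 := by
    refine key _ (d.W 2 (3 * k)) ?_ ?_
    · simp only [b]; rw [H.e2W (by omega), if_pos (by omega), H.S2, hS2]
    · intro i hi
      right
      cases i with
      | e1 => simp only [b]; rw [H.e1W (by omega), if_pos (by omega), map_zero]
      | e2 => exact absurd rfl hi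
      | s1 => simp only [b]; rw [H.SW _ _ (by omega), map_zero]
      | s2 => simp only [b]; rw [H.psiEW hW (by omega) (by omega)]
      | et t h1 h2 => simp only [b]; rw [H.psiEW hW (by omega) (by omega)]
      | w p l hp h1 h2 =>
        simp only [b]; rw [H.psiWW hW hE h1 (by omega), if_neg (by omega), if_neg (by omega), add_zero]
  have fw' : ∀ p l hp h1 h2, (f (.w 0 1 (by omega) (by omega) (by omega)) = 0 ∨ ¬ (p = 1 ∧ l = 3 * k - 1)) →
      f (.w p l hp h1 h2) = 0 := by
    intro p l hp h1 h2 h0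
    refine key _ (d.W (p + l) (3 * k - l)) ?_ ?_
    · simp only [b]; rw [← W_add, show l + (3 * k - l) = 3 * k by omega, hW _ _ (by omega), if_pos rfl]
    · intro i hi
      cases i with
      | e1 => exact Or.inl fe1
      | e2 => exact Or.inl fe2
      | s1 => right; simp only [b]; rw [H.SW _ _ (by omega), map_zero]
      | s2 => right; simp only [b]; rw [H.psiEW hW (by omega) (by omega)]
      | et t h1 h2 => right; simp only [b]; rw [H.psiEW hW (by omega) (by omega)]
      | w p' l' hp' h1' h2' =>
        have hne : ¬ (p = p' ∧ l = l') := by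
          rintro ⟨rfl, rfl⟩; exact hi rfl
        by_cases hc : p' = 0 ∧ l' = 1 ∧ p = 1 ∧ l = 3 * k - 1
        · obtain ⟨rfl, rfl, h⟩ := hc
          left; tauto
        · right
          simp only [b]; rw [H.psiWW hW hE h1' (by omega), if_neg (by omega), if_neg (by omega), add_zero]
  have f01 : f (.w 0 1 (by omega) (by omega) (by omega)) = 0 := fw' _ _ _ _ _ (Or.inr (by omega))
  have fw : ∀ p l hp h1 h2, f (.w p l hp h1 h2) = 0 := fun p l hp h1 h2 => fw' _ _ _ _ _ (Or.inl f01)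
  have fet : ∀ t h1 h2, f (.et t h1 h2) = 0 := by
    intro t h1 h2
    refine key _ (d.et ^ (s - t)) ?_ ?_
    · simp only [b]; rw [← pow_add, show t + (s - t) = s by omega, hS2]
    · intro i hi
      cases i with
      | e1 => exact Or.inl fe1
      | e2 => exact Or.inl fe2
      | s1 => right; simp only [b]; rw [H.psiWE hW (by omega) (by omega)]
      | s2 => right; simp only [b]; rw [← pow_add, H.etabig (by omega), map_zero]
      | et t' h1' h2' =>
        right
        have hne : t ≠ t' := by
          rintro rfl; exact hi rfl
        simp only [b]; rw [← pow_add, hE _ (by omega), if_neg (by omega)]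
      | w p l hp h1 h2 => exact Or.inl (fw _ _ _ _ _)
  have fs1 : f .s1 = 0 := by
    refine key _ d.e1 ?_ ?_
    · simp only [b]; rw [H.We1 (by omega), if_neg (by omega), hS0]
    · intro i hi
      cases i with
      | e1 => exact Or.inl fe1
      | e2 => exact Or.inl fe2
      | s1 => exact absurd rfl hi
      | s2 => right; simp only [b]; rw [H.ep1 (by omega), map_zero]
      | et t h1 h2 => exact Or.inl (fet _ _ _)
      | w p l hp h1 h2 => exact Or.inl (fw _ _ _ _ _)
  have fs2 : f .s2 = 0 := by
    refine key _ d.e2 ?_ ?_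
    · simp only [b]; rw [H.ep2 (by omega), hS2]
    · intro i hi
      cases i with
      | e1 => exact Or.inl fe1
      | e2 => exact Or.inl fe2
      | s1 => exact Or.inl fs1
      | s2 => exact absurd rfl hi
      | et t h1 h2 => exact Or.inl (fet _ _ _)
      | w p l hp h1 h2 => exact Or.inl (fw _ _ _ _ _)
  have : f = 0 := by
    ext i
    cases i with
    | e1 => exact fe1
    | e2 => exact fe2
    | s1 => exact fs1
    | s2 => exact fs2
    | et t h1 h2 => exact fet _ _ _
    | w p l hp h1 h2 => exact fw _ _ _ _ _
  simp [this]

omit hW hE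

/-- values of psi from a vanishing hypothesis on elements other than the socle elements -/
theorem hW_of (h1 : ψ (d.et ^ s) = 1) (h2 : ψ (d.W 0 (3 * k)) = 1)
    (h3 : ∀ p l, p < 3 → 1 ≤ l → l < 3 * k → d.W p l ≠ d.et ^ s → d.W p l ≠ d.W 0 (3 * k) →
      ψ (d.W p l) = 0) (p l : ℕ) (hl : 1 ≤ l) : ψ (d.W p l) = if l = 3 * k then 1 else 0 := by
  have hk := H.hk
  have hS : ∀ p, ψ (d.W p (3 * k)) = 1 := by
    intro p
    rw [d.W_congr (q := p % 3) (by omega)]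
    rcases m3 p with hp | hp | hp <;> rw [hp]
    · exact h2
    · rw [← H.S01, h2]
    · rw [H.S2, h1]
  rcases lt_trichotomy l (3 * k) with h | h | h
  · rw [if_neg (by omega)]
    have ne : ∀ q, d.W p l ≠ d.W q (3 * k) := by
      intro q hq
      have h5 := hS p
      rw [d.W_split l (3 * k - l) (by omega), hq, H.SW _ _ (by omega), map_zero] at h5
      exact zero_ne_one h5
    rw [d.W_congr (q := p % 3) (by omega)] at ne ⊢
    refine h3 _ _ (by omega) hl h ?_ (ne 0)
    rw [← H.S2]; exact ne 2
  · rw [if_pos h, h, hS]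
  · rw [H.Wbig _ h, if_neg (by omega), map_zero]

theorem hE_of (h1 : ψ (d.et ^ s) = 1)
    (h3 : ∀ t, 1 ≤ t → t < s → d.et ^ t ≠ d.et ^ s → d.et ^ t ≠ d.W 0 (3 * k) →
      ψ (d.et ^ t) = 0) (t : ℕ) (ht : 1 ≤ t) : ψ (d.et ^ t) = if t = s then 1 else 0 := by
  have hk := H.hk
  rcases lt_trichotomy t s with h | h | h
  · rw [if_neg (by omega)]
    have ne : ∀ q, d.et ^ t ≠ d.W q (3 * k) := by
      intro q hq
      have h5 : d.et ^ t * d.et ^ (s - t) = d.et ^ s := by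
        rw [← pow_add, show t + (s - t) = s by omega]
      rw [hq, show s - t = 1 + (s - t - 1) by omega, pow_add, ← mul_assoc, pow_one,
        H.Weta (by omega), zero_mul] at h5
      rw [← h5, map_zero] at h1
      exact zero_ne_one h1
    refine h3 _ ht h ?_ (ne 0)
    rw [← H.S2]; exact ne 2
  · rw [if_pos h, h, h1]
  · rw [H.etabig h, if_neg (by omega), map_zero]

end Ok
end Dat

namespace QT

noncomputable def dat (K : Type) [Field K] (k s : ℕ) (a c : K) : Dat (Aa K k s a c) :=
  ⟨E1 K k s a c, E2 K k s a c, Al K k s a c, Be K k s a c, Ga K k s a c, Et K k s a c⟩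

theorem dW0 {A : Type} [Ring A] (d : Dat A) : d.W 0 3 = d.al * d.be * d.ga := by
  simp [Dat.W3, Dat.L]
theorem dW1 {A : Type} [Ring A] (d : Dat A) : d.W 1 3 = d.be * d.ga * d.al := by
  simp [Dat.W3, Dat.L]
theorem dW2 {A : Type} [Ring A] (d : Dat A) : d.W 2 3 = d.ga * d.al * d.be := by
  simp [Dat.W3, Dat.L]

theorem dWz {A : Type} [Ring A] (d : Dat A) (p : ℕ) : d.W p 0 = 1 := rfl

theorem W3n {A : Type} [Ring A] (d : Dat A) (p n m : ℕ) :
    d.W p (3 * n + m) = (d.W p 3) ^ n * d.W p m := by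
  rw [d.W_add, d.W_pow, d.W_congr (p := p + 3 * n) (q := p) (by omega)]

theorem ok (K : Type) [Field K] (k s : ℕ) (hk : 1 ≤ k) (hs : 3 ≤ s) (a c : K) :
    (dat K k s a c).Ok K k s a c := by
  have R : ∀ {x y}, Rel K k s a c x y →
    RingQuot.mkAlgHom K (Rel K k s a c) x = RingQuot.mkAlgHom K (Rel K k s a c) y :=
    fun h => RingQuot.mkAlgHom_rel K h
  have hk3 : 3 * k - 1 = 3 * (k - 1) + 2 := by omega
  refine ⟨hk, hs, ?_, ?_, ?_, ?_, ?_, ?_, ?_, ?_, ?_, ?_, ?_, ?_, ?_, ?_, ?_, ?_, ?_, ?_, ?_, ?_⟩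
  · simpa [dat, E1, E2, Al, Be, Ga, Et] using R .idem1
  · simpa [dat, E1, E2, Al, Be, Ga, Et] using R .idem2
  · simpa [dat, E1, E2, Al, Be, Ga, Et] using R .orth12
  · simpa [dat, E1, E2, Al, Be, Ga, Et] using R .orth21
  · simpa [dat, E1, E2, Al, Be, Ga, Et] using R .sum_idem
  · simpa [dat, E1, E2, Al, Be, Ga, Et] using R .al_left
  · simpa [dat, E1, E2, Al, Be, Ga, Et] using R .al_right
  · simpa [dat, E1, E2, Al, Be, Ga, Et] using R .be_left
  · simpa [dat, E1, E2, Al, Be, Ga, Et] using R .be_right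
  · simpa [dat, E1, E2, Al, Be, Ga, Et] using R .ga_left
  · simpa [dat, E1, E2, Al, Be, Ga, Et] using R .ga_right
  · simpa [dat, E1, E2, Al, Be, Ga, Et] using R .et_left
  · simpa [dat, E1, E2, Al, Be, Ga, Et] using R .et_right
  · rw [hk3, W3n, dW0, Dat.W2]
    simpa [Dat.L, dat, E1, E2, Al, Be, Ga, Et] using R .rel_beta_eta
  · rw [hk3, W3n, dW2, Dat.W2]
    simpa [Dat.L, dat, E1, E2, Al, Be, Ga, Et] using R .rel_eta_gamma
  · rw [hk3, W3n, dW1, Dat.W2, Dat.W_pow, dW1]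
    simpa [Dat.L, dat, E1, E2, Al, Be, Ga, Et] using R .rel_alpha_sq
  · simpa [dat, E1, E2, Al, Be, Ga, Et] using R .rel_gamma_beta
  · simpa [dat, E1, E2, Al, Be, Ga, Et] using R .rel_alpha_sq_beta
  · simpa [dat, E1, E2, Al, Be, Ga, Et] using R .rel_gamma_alpha_sq
  · intro S h1 hS u
    obtain ⟨x, rfl⟩ := RingQuot.mkAlgHom_surjective K (Rel K k s a c) u
    have : ∀ x : FreeAlgebra K Gen, ∀ u ∈ S, u * RingQuot.mkAlgHom K (Rel K k s a c) x ∈ S := by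
      intro x
      induction x using FreeAlgebra.induction with
      | grade0 r =>
        intro u hu
        rw [AlgHom.commutes, ← Algebra.commutes, ← Algebra.smul_def]
        exact S.smul_mem _ hu
      | grade1 g =>
        intro u hu
        obtain ⟨a1, a2, a3, a4, a5, a6⟩ := hS u hu
        cases g
        · exact a1
        · exact a2
        · exact a3
        · exact a4
        · exact a5
        · exact a6
      | mul x y hx hy =>
        intro u hu
        rw [map_mul, ← mul_assoc]
        exact hy _ (hx _ hu)
      | add x y hx hy =>
        intro u hu
        rw [map_add, mul_add]
        exact add_mem (hx _ hu) (hy _ hu)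
    simpa using this x 1 h1

end QT

open QT in
/-- The bilinear form ⟨u,v⟩ := ψ(uv) on `A^{k,s}(a,c)` is symmetric,
associative (⟨uv,w⟩ = ⟨u,vw⟩) and nondegenerate; in particular `A^{k,s}(a,c)` is a
symmetric K-algebra. -/
theorem statement1 (K : Type) [Field K] (k s : ℕ) (hk : 1 ≤ k) (hs : 3 ≤ s)
    (a c : K) (ha : a ≠ 0)
    (ψ : Aa K k s a c →ₗ[K] K) (hψ : IsPsi K k s a c ψ) :
    (∀ u v : Aa K k s a c, ψ (u * v) = ψ (v * u)) ∧
      (∀ u v w : Aa K k s a c, ψ ((u * v) * w) = ψ (u * (v * w))) ∧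
      (∀ u : Aa K k s a c, (∀ v : Aa K k s a c, ψ (u * v) = 0) → u = 0) := by
  have H := ok K k s hk hs a c
  obtain ⟨h1, h2, h3⟩ := hψ
  have hS : (dat K k s a c).W 0 (3 * k) = (Al K k s a c * Be K k s a c * Ga K k s a c) ^ k := by
    rw [Dat.W_pow, dW0]; rfl
  have comm3 : ∀ x y z : Aa K k s a c, ∀ n : ℕ, x * (y * z * x) ^ n = (x * y * z) ^ n * x := by
    intro x y z n
    induction n with
    | zero => simp
    | succ n ih => rw [pow_succ, ← mul_assoc, ih, pow_succ]; simp only [mul_assoc]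
  have hb : ∀ p l, p < 3 → 1 ≤ l → l < 3 * k → ∃ i, bVec K k s a c i = (dat K k s a c).W p l := by
    intro p l hp hl hl'
    obtain ⟨n, m, hm, rfl⟩ : ∃ n m, m < 3 ∧ l = 3 * n + m := ⟨l / 3, l % 3, by omega, by omega⟩
    rw [W3n]
    interval_cases p <;> interval_cases m <;> simp only [dW0, dW1, dW2, Dat.W1, Dat.W2, dWz]
    · exact ⟨.inl (.inr (.inr ⟨n, by omega⟩)), by simp [bVec, dat]⟩
    · exact ⟨.inl (.inl (.inl ⟨n, by omega⟩)), by simp [bVec, dat, Dat.L, comm3]⟩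
    · exact ⟨.inr (.inr (.inl (.inr ⟨n, by omega⟩))), by
        simp only [bVec, comm3]; rw [mul_assoc]; simp [dat, Dat.L]⟩
    · exact ⟨.inl (.inr (.inl ⟨n - 1, by omega⟩)), by
        simp [bVec, dat, Dat.L, show n - 1 + 1 = n by omega]⟩
    · exact ⟨.inr (.inr (.inl (.inl ⟨n, by omega⟩))), by simp [bVec, dat, Dat.L]⟩
    · exact ⟨.inl (.inl (.inr ⟨n, by omega⟩)), by simp [bVec, dat, Dat.L]⟩
    · exact ⟨.inr (.inl (.inr ⟨n - 1, by omega⟩)), by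
        simp [bVec, dat, Dat.L, show n - 1 + 1 = n by omega]⟩
    · exact ⟨.inr (.inr (.inr (.inl ⟨n, by omega⟩))), by simp [bVec, dat, Dat.L]⟩
    · exact ⟨.inr (.inr (.inr (.inr ⟨n, by omega⟩))), by simp [bVec, dat, Dat.L]⟩
  have hW := H.hW_of (ψ := ψ) h1 (by rw [hS]; exact h2) (by
    intro p l hp hl hl' n1 n2
    obtain ⟨i, hi⟩ := hb p l hp hl hl'
    rw [hS] at n2
    rw [← hi] at n1 n2 ⊢
    exact h3 i n1 n2)
  have hE := H.hE_of (ψ := ψ) h1 (by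
    intro t ht ht' n1 n2
    rw [hS] at n2
    exact h3 (.inr (.inl (.inl ⟨t, by omega⟩))) n1 n2)
  exact ⟨H.symm hW hE, fun u v w => by rw [mul_assoc], H.nondeg hW hE⟩
end

section
/- The images of e₁, e₂, α, (αβγ)^m for 1 ≤ m ≤ k, and η^t for 1 ≤ t ≤ s−1 form a K-basis of the commutator quotient A^{k,s}(a,c)/[A,A]; in particular dim_K A^{k,s}(a,c)/[A,A] = k + s + 2. Moreover η^s − (αβγ)^k ∈ [A,A], (αβγ)^m − (βγα)^m ∈ [A,A] and (αβγ)^m − (γαβ)^m ∈ [A,A] for all m ≥ 1, α(βγα)^n ∈ [A,A] for all n ≥ 1, and (βγα)^m βγ ∈ [A,A] for all m ≥ 1. -/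
namespace QT

/-- Index type for the claimed basis of the commutator quotient:
e₁, e₂, α, (αβγ)^m for 1 ≤ m ≤ k, η^t for 1 ≤ t ≤ s−1. -/
abbrev CIdx (k s : ℕ) : Type := (Unit ⊕ Unit ⊕ Unit) ⊕ (Fin k ⊕ Fin (s - 1))

/-- The family e₁, e₂, α, (αβγ)^m (1 ≤ m ≤ k), η^t (1 ≤ t ≤ s−1) in `A^{k,s}(a,c)`. -/
noncomputable def cVec (K : Type) [Field K] (k s : ℕ) (a c : K) :
    CIdx k s → Aa K k s a c := fun i =>
  match i with
  | .inl (.inl _) => E1 K k s a c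
  | .inl (.inr (.inl _)) => E2 K k s a c
  | .inl (.inr (.inr _)) => Al K k s a c
  | .inr (.inl m) => (Al K k s a c * Be K k s a c * Ga K k s a c) ^ ((m : ℕ) + 1)
  | .inr (.inr t) => (Et K k s a c) ^ ((t : ℕ) + 1)

end QT

namespace QT

structure Pres {K A : Type} [Field K] [Ring A] [Algebra K A] (k s : ℕ) (a c : K)
    (e₁ e₂ α β γ η : A) : Prop where
  e11 : e₁ * e₁ = e₁
  e22 : e₂ * e₂ = e₂
  e12 : e₁ * e₂ = 0
  e21 : e₂ * e₁ = 0
  es : e₁ + e₂ = 1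
  e1a : e₁ * α = α
  ae1 : α * e₁ = α
  e1b : e₁ * β = β
  be2 : β * e₂ = β
  e2g : e₂ * γ = γ
  ge1 : γ * e₁ = γ
  e2h : e₂ * η = η
  he2 : η * e₂ = η
  bh : β * η = (α * (β * γ)) ^ (k - 1) * (α * β)
  hg : η * γ = (γ * (α * β)) ^ (k - 1) * (γ * α)
  aa : α * α = a • ((β * (γ * α)) ^ (k - 1) * (β * γ)) + c • (β * (γ * α)) ^ k
  gb : γ * β = η ^ (s - 1)
  aab : α * (α * β) = 0
  gaa : γ * (α * α) = 0

/-- commutator space -/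
def cm (K A : Type) [Field K] [Ring A] [Algebra K A] : Submodule K A :=
  Submodule.span K {z : A | ∃ u v : A, z = u * v - v * u}

theorem cm_mem {K A : Type} [Field K] [Ring A] [Algebra K A] (u v : A) :
    u * v - v * u ∈ cm K A := Submodule.subset_span ⟨u, v, rfl⟩

theorem mul_pow_shift {A : Type} [Ring A] (x y : A) (n : ℕ) :
    (x * y) ^ n * x = x * (y * x) ^ n := by
  induction n with
  | zero => simp
  | succ n ih => rw [pow_succ', mul_assoc, ih, pow_succ']; simp only [mul_assoc]

namespace Pres

variable {K A : Type} [Field K] [Ring A] [Algebra K A] {k s : ℕ} {a c : K}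
    {e₁ e₂ α β γ η : A} (h : Pres k s a c e₁ e₂ α β γ η)

theorem mz {x y : A} {e e' : A} (h1 : x * e = x) (h2 : e' * y = y) (h3 : e * e' = 0) :
    x * y = 0 := by
  rw [← h1, ← h2, mul_assoc, ← mul_assoc e, h3]; simp

include h

theorem ag : α * γ = 0 := mz h.ae1 h.e2g h.e12
theorem ah : α * η = 0 := mz h.ae1 h.e2h h.e12
theorem bb : β * β = 0 := mz h.be2 h.e1b h.e21
theorem ba : β * α = 0 := mz h.be2 h.e1a h.e21
theorem gg : γ * γ = 0 := mz h.ge1 h.e2g h.e12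
theorem gh : γ * η = 0 := mz h.ge1 h.e2h h.e12
theorem ha : η * α = 0 := mz h.he2 h.e1a h.e21
theorem hb : η * β = 0 := mz h.he2 h.e1b h.e21
theorem ae2 : α * e₂ = 0 := mz h.ae1 h.e22 h.e12
theorem be1 : β * e₁ = 0 := mz h.be2 h.e11 h.e21
theorem ge2 : γ * e₂ = 0 := mz h.ge1 h.e22 h.e12
theorem he1 : η * e₁ = 0 := mz h.he2 h.e11 h.e21
theorem e1g : e₁ * γ = 0 := mz h.e11 h.e2g h.e12
theorem e1h : e₁ * η = 0 := mz h.e11 h.e2h h.e12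
theorem e2a : e₂ * α = 0 := mz h.e22 h.e1a h.e21
theorem e2b : e₂ * β = 0 := mz h.e22 h.e1b h.e21

theorem aabz (z : A) : α * (α * (β * z)) = 0 := by
  have := congrArg (· * z) h.aab
  simpa [mul_assoc] using this

theorem aP (n : ℕ) : α * ((α * (β * γ)) ^ n * (α * β)) = 0 := by
  cases n with
  | zero => simpa using h.aab
  | succ n => rw [pow_succ']; simp [mul_assoc, h.aabz]

theorem abh : α * (β * η) = 0 := by rw [h.bh, h.aP]

theorem bhh : β * (η * η) = 0 := by
  rw [← mul_assoc, h.bh]; simp [mul_assoc, h.abh]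

theorem bgb (hs : 3 ≤ s) : β * (γ * β) = 0 := by
  rw [h.gb]
  obtain ⟨t, rfl⟩ := Nat.exists_eq_add_of_le hs
  have : 3 + t - 1 = (t + 1) + 1 := by omega
  rw [this, pow_succ', pow_succ', ← mul_assoc η, ← mul_assoc, h.bhh, zero_mul]

theorem hgab : η * (γ * (α * β)) = 0 := by
  rw [← mul_assoc, h.hg]; simp [mul_assoc, h.aab]

theorem hgabz (z : A) : η * (γ * (α * (β * z))) = 0 := by
  have := congrArg (· * z) h.hgab
  simpa [mul_assoc] using this

theorem hhg : η * (η * γ) = 0 := by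
  have hg := h.hg
  rw [hg]
  cases hn : k - 1 with
  | zero =>
    rw [hn] at hg
    rw [pow_zero, one_mul, ← mul_assoc, hg]
    simp [mul_assoc, h.gaa]
  | succ n => rw [pow_succ']; simp [mul_assoc, h.hgabz]

theorem gbg (hs : 3 ≤ s) : γ * (β * γ) = 0 := by
  rw [← mul_assoc, h.gb]
  obtain ⟨t, rfl⟩ := Nat.exists_eq_add_of_le hs
  have : 3 + t - 1 = (t + 1) + 1 := by omega
  rw [this, pow_succ, pow_succ, mul_assoc, mul_assoc, h.hhg, mul_zero]

theorem gbgz (hs : 3 ≤ s) (z : A) : γ * (β * (γ * z)) = 0 := by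
  have := congrArg (· * z) (h.gbg hs)
  simpa [mul_assoc] using this

theorem Pk_eq (hk : 1 ≤ k) : (α * (β * γ)) ^ k = (β * (γ * α)) ^ k := by
  obtain ⟨n, rfl⟩ := Nat.exists_eq_add_of_le' hk
  have h1 : β * η * γ = (α * (β * γ)) ^ (n + 1) := by
    rw [h.bh, pow_succ]; simp [mul_assoc]
  have h2 : β * (η * γ) = (β * (γ * α)) ^ (n + 1) := by
    rw [h.hg, pow_succ]
    have := mul_pow_shift β (γ * α) n
    simp only [mul_assoc] at this
    simp only [Nat.add_sub_cancel, ← mul_assoc] at this ⊢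
    rw [← this]
  rw [← h1, ← h2, mul_assoc]

theorem Pbig (hk : 1 ≤ k) (n : ℕ) (hn : k + 1 ≤ n) : (α * (β * γ)) ^ n = 0 := by
  obtain ⟨m, rfl⟩ := Nat.exists_eq_add_of_le hn
  rw [pow_add, pow_succ, h.Pk_eq hk]
  obtain ⟨j, rfl⟩ := Nat.exists_eq_add_of_le' hk
  rw [pow_succ]
  simp [mul_assoc, h.aabz]

theorem etas (hs : 3 ≤ s) (hk : 1 ≤ k) : η ^ s = (γ * (α * β)) ^ k := by
  obtain ⟨t, rfl⟩ := Nat.exists_eq_add_of_le hs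
  have : 3 + t = (3 + t - 1) + 1 := by omega
  rw [this, pow_succ, ← h.gb, mul_assoc, h.bh]
  obtain ⟨j, rfl⟩ := Nat.exists_eq_add_of_le' hk
  have := mul_pow_shift γ (α * β) j
  simp only [mul_assoc] at this
  simp only [Nat.add_sub_cancel]
  rw [← mul_assoc, ← this, pow_succ]
  simp only [mul_assoc]

theorem etabig (hs : 3 ≤ s) (hk : 1 ≤ k) (n : ℕ) (hn : s + 1 ≤ n) : η ^ n = 0 := by
  obtain ⟨m, rfl⟩ := Nat.exists_eq_add_of_le hn
  rw [pow_add, pow_succ', h.etas hs hk]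
  obtain ⟨j, rfl⟩ := Nat.exists_eq_add_of_le' hk
  rw [pow_succ']
  simp [mul_assoc, h.hgabz]

omit h in
theorem cm_PR (n : ℕ) : (α * (β * γ)) ^ (n + 1) - (β * (γ * α)) ^ (n + 1) ∈ cm K A := by
  have := cm_mem (K := K) α ((β * (γ * α)) ^ n * (β * γ))
  have e := mul_pow_shift α (β * γ) n
  simp only [mul_assoc] at e
  rw [pow_succ, pow_succ, ← mul_assoc _ α, e]
  simpa only [mul_assoc] using this

omit h in
theorem cm_PQ (n : ℕ) : (α * (β * γ)) ^ (n + 1) - (γ * (α * β)) ^ (n + 1) ∈ cm K A := by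
  have := cm_mem (K := K) (α * β) (γ * (α * (β * γ)) ^ n)
  have e := mul_pow_shift γ (α * β) n
  have e' := mul_pow_shift (α * β) γ n
  simp only [mul_assoc] at e e'
  rw [pow_succ, pow_succ (γ * (α * β))]
  have e1 : (α * (β * γ)) ^ n * (α * (β * γ)) = α * (β * (γ * (α * (β * γ)) ^ n)) := by
    rw [← e, ← pow_succ, pow_succ']
    simp only [mul_assoc, e]
  have e2 : (γ * (α * β)) ^ n * (γ * (α * β)) = γ * ((α * (β * γ)) ^ n * (α * β)) := by
    rw [← mul_assoc _ γ, e]; simp only [mul_assoc]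
  rw [e1, e2]
  simpa only [mul_assoc] using this

theorem cm_aR (n : ℕ) : α * (β * (γ * α)) ^ (n + 1) ∈ cm K A := by
  have := cm_mem (K := K) (α * ((β * (γ * α)) ^ n * (β * γ))) α
  have e : α * (α * ((β * (γ * α)) ^ n * (β * γ))) = 0 := by
    cases n with
    | zero => simp [h.aabz]
    | succ n => rw [pow_succ']; simp [mul_assoc, h.aabz]
  rw [e, sub_zero] at this
  rw [pow_succ]
  simpa only [mul_assoc] using this

theorem cm_Rb (hs : 3 ≤ s) (n : ℕ) : (β * (γ * α)) ^ (n + 1) * (β * γ) ∈ cm K A := by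
  have := cm_mem (K := K) ((β * (γ * α)) ^ (n + 1) * β) γ
  have e : γ * ((β * (γ * α)) ^ (n + 1) * β) = 0 := by
    rw [pow_succ']; simp [mul_assoc, h.gbgz hs]
  rw [e, sub_zero] at this
  simpa only [mul_assoc] using this

omit h in
theorem off12 (x : A) (h1 : e₁ * x = x) (h2 : x * e₁ = 0) : x ∈ cm K A := by
  have := cm_mem (K := K) e₁ x
  simpa [h1, h2] using this

omit h in
theorem off21 (x : A) (h1 : e₁ * x = 0) (h2 : x * e₁ = x) : x ∈ cm K A := by
  have := cm_mem (K := K) x e₁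
  simpa [h1, h2] using this

/-- the spanning family -/
inductive Fam (e₁ e₂ α β γ η : A) : A → Prop
  | e1 : Fam e₁ e₂ α β γ η e₁
  | e2 : Fam e₁ e₂ α β γ η e₂
  | h (n : ℕ) : Fam e₁ e₂ α β γ η (η ^ n * η)
  | Pa (n : ℕ) : Fam e₁ e₂ α β γ η ((α * (β * γ)) ^ n * α)
  | Pab (n : ℕ) : Fam e₁ e₂ α β γ η ((α * (β * γ)) ^ n * (α * β))
  | Pabg (n : ℕ) : Fam e₁ e₂ α β γ η ((α * (β * γ)) ^ n * (α * (β * γ)))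
  | Rb (n : ℕ) : Fam e₁ e₂ α β γ η ((β * (γ * α)) ^ n * β)
  | Rbg (n : ℕ) : Fam e₁ e₂ α β γ η ((β * (γ * α)) ^ n * (β * γ))
  | Rbga (n : ℕ) : Fam e₁ e₂ α β γ η ((β * (γ * α)) ^ n * (β * (γ * α)))
  | Qg (n : ℕ) : Fam e₁ e₂ α β γ η ((γ * (α * β)) ^ n * γ)
  | Qga (n : ℕ) : Fam e₁ e₂ α β γ η ((γ * (α * β)) ^ n * (γ * α))
  | Qgab (n : ℕ) : Fam e₁ e₂ α β γ η ((γ * (α * β)) ^ n * (γ * (α * β)))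

omit h in
theorem fm {x : A} (hx : Fam e₁ e₂ α β γ η x) :
    x ∈ Submodule.span K {x | Fam e₁ e₂ α β γ η x} := Submodule.subset_span hx

theorem fam_e1 {x : A} (hx : Fam e₁ e₂ α β γ η x) :
    x * e₁ ∈ Submodule.span K {x | Fam e₁ e₂ α β γ η x} := by
  have hx' := fm (K := K) hx
  cases hx <;> simp only [mul_assoc, h.e11, h.e21, h.ae1, h.be1, h.ge1, h.he1, mul_zero, Submodule.zero_mem] <;> exact hx'

theorem fam_e2 {x : A} (hx : Fam e₁ e₂ α β γ η x) :
    x * e₂ ∈ Submodule.span K {x | Fam e₁ e₂ α β γ η x} := by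
  have hx' := fm (K := K) hx
  cases hx <;> simp only [mul_assoc, h.e12, h.e22, h.ae2, h.be2, h.ge2, h.he2, mul_zero, Submodule.zero_mem] <;> exact hx'

theorem fam_h {x : A} (hx : Fam e₁ e₂ α β γ η x) :
    x * η ∈ Submodule.span K {x | Fam e₁ e₂ α β γ η x} := by
  cases hx <;> simp only [mul_assoc, h.e1h, h.e2h, h.ah, h.gh, h.abh, mul_zero, Submodule.zero_mem]
  case e2 => simpa using fm (K := K) (Fam.h (e₁ := e₁) (e₂ := e₂) (α := α) (β := β) (γ := γ) (η := η) 0)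
  case h n => simpa [pow_succ, mul_assoc] using fm (K := K) (Fam.h (e₁ := e₁) (e₂ := e₂) (α := α) (β := β) (γ := γ) (η := η) (n+1))
  case Rb n =>
    cases n with
    | zero => rw [pow_zero, one_mul, h.bh]; exact fm (Fam.Pab _)
    | succ n => rw [pow_succ]; simp [mul_assoc, h.abh]

theorem fam_a (hk : 1 ≤ k) {x : A} (hx : Fam e₁ e₂ α β γ η x) :
    x * α ∈ Submodule.span K {x | Fam e₁ e₂ α β γ η x} := by
  cases hx <;> simp only [mul_assoc, h.e1a, h.e2a, h.ba, h.ha, h.gaa, mul_zero, Submodule.zero_mem]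
  case e1 => simpa using fm (K := K) (Fam.Pa (e₁ := e₁) (e₂ := e₂) (α := α) (β := β) (γ := γ) (η := η) 0)
  case Pa n =>
    cases n with
    | zero =>
      rw [pow_zero, one_mul, h.aa]
      refine Submodule.add_mem _ (Submodule.smul_mem _ _ (fm (Fam.Rbg _))) (Submodule.smul_mem _ _ ?_)
      obtain ⟨j, rfl⟩ := Nat.exists_eq_add_of_le' hk
      rw [pow_succ]
      exact fm (Fam.Rbga _)
    | succ n => rw [pow_succ]; simp [mul_assoc, h.gaa]
  case Pabg n => simpa [pow_succ, mul_assoc] using fm (K := K) (Fam.Pa (e₁ := e₁) (e₂ := e₂) (α := α) (β := β) (γ := γ) (η := η) (n+1))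
  case Rbg n => exact fm (Fam.Rbga _)
  case Qg n => exact fm (Fam.Qga _)

theorem fam_b (hs : 3 ≤ s) {x : A} (hx : Fam e₁ e₂ α β γ η x) :
    x * β ∈ Submodule.span K {x | Fam e₁ e₂ α β γ η x} := by
  cases hx <;> simp only [mul_assoc, h.e1b, h.e2b, h.bb, h.hb, h.bgb hs, mul_zero, Submodule.zero_mem]
  case e1 => simpa using fm (K := K) (Fam.Rb (e₁ := e₁) (e₂ := e₂) (α := α) (β := β) (γ := γ) (η := η) 0)
  case Pa n => exact fm (Fam.Pab _)
  case Rbga n => simpa [pow_succ, mul_assoc] using fm (K := K) (Fam.Rb (e₁ := e₁) (e₂ := e₂) (α := α) (β := β) (γ := γ) (η := η) (n+1))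
  case Qg n =>
    cases n with
    | zero =>
      rw [pow_zero, one_mul, h.gb]
      have : s - 1 = (s - 2) + 1 := by omega
      rw [this, pow_succ]
      exact fm (Fam.h _)
    | succ n => rw [pow_succ]; simp [mul_assoc, h.bgb hs]
  case Qga n => exact fm (Fam.Qgab _)

theorem fam_g {x : A} (hx : Fam e₁ e₂ α β γ η x) :
    x * γ ∈ Submodule.span K {x | Fam e₁ e₂ α β γ η x} := by
  cases hx <;> simp only [mul_assoc, h.e1g, h.e2g, h.ag, h.gg, mul_zero, Submodule.zero_mem]
  case e2 => simpa using fm (K := K) (Fam.Qg (e₁ := e₁) (e₂ := e₂) (α := α) (β := β) (γ := γ) (η := η) 0)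
  case h n =>
    cases n with
    | zero => rw [pow_zero, one_mul, h.hg]; exact fm (Fam.Qga _)
    | succ n => rw [pow_succ]; simp [mul_assoc, h.hhg]
  case Pab n => exact fm (Fam.Pabg _)
  case Rb n => exact fm (Fam.Rbg _)
  case Qgab n => simpa [pow_succ, mul_assoc] using fm (K := K) (Fam.Qg (e₁ := e₁) (e₂ := e₂) (α := α) (β := β) (γ := γ) (η := η) (n+1))

theorem fam_S (hk : 1 ≤ k) (hs : 3 ≤ s) (S : Submodule K A) (hS : cm K A ≤ S)
    (he1 : e₁ ∈ S) (he2 : e₂ ∈ S) (ha : α ∈ S)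
    (hP : ∀ m, m + 1 ≤ k → (α * (β * γ)) ^ (m + 1) ∈ S)
    (hη : ∀ t, t + 1 ≤ s - 1 → η ^ (t + 1) ∈ S) {x : A} (hx : Fam e₁ e₂ α β γ η x) : x ∈ S := by
  have hP' : ∀ m, (α * (β * γ)) ^ (m + 1) ∈ S := by
    intro m
    by_cases hm : m + 1 ≤ k
    · exact hP m hm
    · rw [h.Pbig hk _ (by omega)]; exact S.zero_mem
  have hQ' : ∀ m, (γ * (α * β)) ^ (m + 1) ∈ S := by
    intro m
    have := S.sub_mem (hP' m) (hS (cm_PQ (α := α) (β := β) (γ := γ) m))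
    simpa using this
  have hR' : ∀ m, (β * (γ * α)) ^ (m + 1) ∈ S := by
    intro m
    have := S.sub_mem (hP' m) (hS (cm_PR (α := α) (β := β) (γ := γ) m))
    simpa using this
  have e1P : ∀ n x, e₁ * x = x → e₁ * ((α * (β * γ)) ^ n * x) = (α * (β * γ)) ^ n * x := by
    intro n x hx
    cases n with
    | zero => simpa using hx
    | succ n => rw [pow_succ', mul_assoc, ← mul_assoc e₁, ← mul_assoc e₁, h.e1a]
  have e1R : ∀ n x, e₁ * x = x → e₁ * ((β * (γ * α)) ^ n * x) = (β * (γ * α)) ^ n * x := by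
    intro n x hx
    cases n with
    | zero => simpa using hx
    | succ n => rw [pow_succ', mul_assoc, ← mul_assoc e₁, ← mul_assoc e₁, h.e1b]
  have e1Q : ∀ n x, e₁ * x = 0 → e₁ * ((γ * (α * β)) ^ n * x) = 0 := by
    intro n x hx
    cases n with
    | zero => simpa using hx
    | succ n => rw [pow_succ', mul_assoc, ← mul_assoc e₁, ← mul_assoc e₁, h.e1g]; simp
  cases hx with
  | e1 => exact he1
  | e2 => exact he2
  | h n =>
    rw [← pow_succ]
    by_cases h1 : n + 1 ≤ s - 1
    · exact hη n h1
    by_cases h2 : n + 1 = s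
    · rw [h2, h.etas hs hk]
      obtain ⟨j, rfl⟩ := Nat.exists_eq_add_of_le' hk
      exact hQ' j
    · rw [h.etabig hs hk _ (by omega)]; exact S.zero_mem
  | Pa n =>
    cases n with
    | zero => simpa using ha
    | succ n =>
      have e := mul_pow_shift α (β * γ) (n + 1)
      rw [e, mul_assoc]
      exact hS (h.cm_aR n)
  | Pab n =>
    refine hS (off12 _ (e1P _ _ ?_) ?_)
    · rw [← mul_assoc, h.e1a]
    · simp [mul_assoc, h.be1]
  | Pabg n => rw [← pow_succ]; exact hP' n
  | Rb n =>
    refine hS (off12 _ (e1R _ _ h.e1b) ?_)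
    simp [mul_assoc, h.be1]
  | Rbg n =>
    cases n with
    | zero =>
      have h1 := hS (cm_mem (K := K) β γ)
      rw [h.gb] at h1
      have h2 := hη (s - 2) (by omega)
      have e : s - 2 + 1 = s - 1 := by omega
      rw [e] at h2
      simpa using S.add_mem h1 h2
    | succ n => exact hS (h.cm_Rb hs n)
  | Rbga n => rw [← pow_succ]; exact hR' n
  | Qg n =>
    refine hS (off21 _ (e1Q _ _ h.e1g) ?_)
    simp [mul_assoc, h.ge1]
  | Qga n =>
    refine hS (off21 _ (e1Q _ _ ?_) ?_)
    · rw [← mul_assoc, h.e1g, zero_mul]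
    · simp [mul_assoc, h.ae1]
  | Qgab n => rw [← pow_succ]; exact hQ' n

end Pres

variable (K : Type) [Field K] (k s : ℕ) (a c : K)

theorem presA : Pres k s a c (E1 K k s a c) (E2 K k s a c) (Al K k s a c) (Be K k s a c)
    (Ga K k s a c) (Et K k s a c) := by
  have key : ∀ x y, Rel K k s a c x y → RingQuot.mkAlgHom K (Rel K k s a c) x =
    RingQuot.mkAlgHom K (Rel K k s a c) y := fun x y h => RingQuot.mkAlgHom_rel K h
  constructor
  · simpa [E1] using key _ _ .idem1
  · simpa [E2] using key _ _ .idem2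
  · simpa [E1, E2] using key _ _ .orth12
  · simpa [E1, E2] using key _ _ .orth21
  · simpa [E1, E2] using key _ _ .sum_idem
  · simpa [E1, Al] using key _ _ .al_left
  · simpa [E1, Al] using key _ _ .al_right
  · simpa [E1, Be] using key _ _ .be_left
  · simpa [E2, Be] using key _ _ .be_right
  · simpa [E2, Ga] using key _ _ .ga_left
  · simpa [E1, Ga] using key _ _ .ga_right
  · simpa [E2, Et] using key _ _ .et_left
  · simpa [E2, Et] using key _ _ .et_right
  · simpa [Al, Be, Ga, Et, mul_assoc] using key _ _ .rel_beta_eta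
  · simpa [Al, Be, Ga, Et, mul_assoc] using key _ _ .rel_eta_gamma
  · simpa [Al, Be, Ga, Et, mul_assoc] using key _ _ .rel_alpha_sq
  · simpa [Al, Be, Ga, Et, mul_assoc] using key _ _ .rel_gamma_beta
  · simpa [Al, Be, Ga, Et, mul_assoc] using key _ _ .rel_alpha_sq_beta
  · simpa [Al, Be, Ga, Et, mul_assoc] using key _ _ .rel_gamma_alpha_sq

theorem fam_top (hk : 1 ≤ k) (hs : 3 ≤ s) :
    Submodule.span K {x | Pres.Fam (E1 K k s a c) (E2 K k s a c) (Al K k s a c) (Be K k s a c)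
      (Ga K k s a c) (Et K k s a c) x} = ⊤ := by
  have h := presA K k s a c
  set N := Submodule.span K {x | Pres.Fam (E1 K k s a c) (E2 K k s a c) (Al K k s a c)
    (Be K k s a c) (Ga K k s a c) (Et K k s a c) x} with hN
  have hg : ∀ g : Gen, ∀ x ∈ N, x * RingQuot.mkAlgHom K (Rel K k s a c) (gen K g) ∈ N := by
    intro g x hx
    induction hx using Submodule.span_induction with
    | mem x hx =>
      cases g
      · exact h.fam_e1 hx
      · exact h.fam_e2 hx
      · exact h.fam_a hk hx
      · exact h.fam_b hs hx
      · exact h.fam_g hx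
      · exact h.fam_h hx
    | zero => simp
    | add x y _ _ h1 h2 => rw [add_mul]; exact N.add_mem h1 h2
    | smul r x _ h1 => rw [smul_mul_assoc]; exact N.smul_mem r h1
  have hall : ∀ y : FreeAlgebra K Gen, ∀ x ∈ N, x * RingQuot.mkAlgHom K (Rel K k s a c) y ∈ N := by
    intro y
    induction y using FreeAlgebra.induction with
    | grade0 r =>
      intro x hx
      rw [AlgHom.commutes, ← Algebra.commutes, ← Algebra.smul_def]
      exact N.smul_mem r hx
    | grade1 g => exact hg g
    | mul y z hy hz => intro x hx; rw [map_mul, ← mul_assoc]; exact hz _ (hy _ hx)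
    | add y z hy hz => intro x hx; rw [map_add, mul_add]; exact N.add_mem (hy _ hx) (hz _ hx)
  rw [eq_top_iff]
  rintro z -
  obtain ⟨y, rfl⟩ := RingQuot.mkAlgHom_surjective K (Rel K k s a c) z
  have h1 : (1 : Aa K k s a c) ∈ N := by
    rw [← h.es]; exact N.add_mem (Pres.fm .e1) (Pres.fm .e2)
  simpa using hall y 1 h1

end QT
namespace QT

open Matrix

/-- repeated word -/
def pw (u : List (Fin 4)) (n : ℕ) : List (Fin 4) := (List.replicate n u).flatten

theorem pw_zero (u : List (Fin 4)) : pw u 0 = [] := rfl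
theorem pw_succ (u : List (Fin 4)) (n : ℕ) : pw u (n + 1) = u ++ pw u n := by
  simp [pw, List.replicate_succ]

theorem pw_shift (u v : List (Fin 4)) (n : ℕ) : pw (u ++ v) n ++ u = u ++ pw (v ++ u) n := by
  induction n with
  | zero => simp [pw_zero]
  | succ n ih => rw [pw_succ, pw_succ, List.append_assoc, ih]; simp

theorem pw_succ_last (u : List (Fin 4)) (n : ℕ) : pw u (n + 1) = pw u n ++ u := by
  have := pw_shift u [] n
  simp only [List.append_nil, List.nil_append] at this
  rw [pw_succ, this]

section
variable (K : Type) [Field K]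

abbrev WA : Type := MonoidAlgebra K (FreeMonoid (Fin 4))

/-- word as an algebra element -/
noncomputable def wd (w : List (Fin 4)) : WA K := MonoidAlgebra.single (FreeMonoid.ofList w) 1

theorem wd_nil : wd K [] = 1 := rfl
theorem wd_mul (u v : List (Fin 4)) : wd K u * wd K v = wd K (u ++ v) := by
  simp [wd, MonoidAlgebra.single_mul_single]

variable {K}

/-- linear extension of a word function -/
noncomputable def ext (f : List (Fin 4) → K) : WA K →ₗ[K] K :=
  (Finsupp.linearCombination K (fun w : FreeMonoid (Fin 4) => f w.toList)) ∘ₗ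
    (MonoidAlgebra.coeffLinearEquiv K).toLinearMap

theorem ext_wd (f : List (Fin 4) → K) (w : List (Fin 4)) : ext f (wd K w) = f w := by
  have : ext f (wd K w) = Finsupp.linearCombination K (fun w : FreeMonoid (Fin 4) => f w.toList)
    (Finsupp.single (FreeMonoid.ofList w) 1) := rfl
  rw [this]; simp

theorem lin_ext {N : Type} [AddCommGroup N] [Module K N] {f g : WA K →ₗ[K] N}
    (h : ∀ w, f (wd K w) = g (wd K w)) : f = g := by
  apply MonoidAlgebra.lhom_ext'
  intro x
  apply LinearMap.ext_ring
  exact h x.toList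

theorem ext_comm (f : List (Fin 4) → K) (hf : ∀ u v, f (u ++ v) = f (v ++ u)) (x y : WA K) :
    ext f (x * y) = ext f (y * x) := by
  have : (LinearMap.mul K (WA K)).compr₂ (ext f) = (LinearMap.mul K (WA K)).flip.compr₂ (ext f) := by
    apply lin_ext
    intro u
    apply lin_ext
    intro v
    simp [wd_mul, ext_wd, hf u v]
  simpa using LinearMap.congr_fun (LinearMap.congr_fun this x) y

theorem ext_mul_congr (f : List (Fin 4) → K) (y z : WA K)
    (h : ∀ w, ext f (wd K w * y) = ext f (wd K w * z)) (m : WA K) :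
    ext f (m * y) = ext f (m * z) := by
  have : (ext f) ∘ₗ (LinearMap.mulRight K y) = (ext f) ∘ₗ (LinearMap.mulRight K z) := by
    apply lin_ext
    intro w
    simpa using h w
  simpa using LinearMap.congr_fun this m

/-- trace functional -/
noncomputable def TT (f : List (Fin 4) → K) : Matrix (Fin 2) (Fin 2) (WA K) →ₗ[K] K :=
  (ext f) ∘ₗ (Matrix.traceLinearMap (Fin 2) K (WA K))

theorem TT_comm (f : List (Fin 4) → K) (hf : ∀ u v, f (u ++ v) = f (v ++ u))
    (M N : Matrix (Fin 2) (Fin 2) (WA K)) : TT f (M * N) = TT f (N * M) := by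
  simp only [TT, LinearMap.comp_apply, Matrix.traceLinearMap_apply, Matrix.trace, Matrix.diag,
    Matrix.mul_apply, Fin.sum_univ_two, map_add]
  rw [ext_comm f hf (M 0 0), ext_comm f hf (M 0 1), ext_comm f hf (M 1 0), ext_comm f hf (M 1 1)]
  ring

theorem TT_single (f : List (Fin 4) → K) (M : Matrix (Fin 2) (Fin 2) (WA K)) (i j : Fin 2)
    (x : WA K) : TT f (M * single i j x) = ext f (M j i * x) := by
  simp [TT, Matrix.trace_mul_single]

theorem TT_congr (f : List (Fin 4) → K) (i j : Fin 2) (y z : WA K)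
    (h : ∀ w, ext f (wd K w * y) = ext f (wd K w * z)) (M : Matrix (Fin 2) (Fin 2) (WA K)) :
    TT f (M * single i j y) = TT f (M * single i j z) := by
  rw [TT_single, TT_single, ext_mul_congr f y z h]

variable (K)

/-- the representation -/
noncomputable def gm : Gen → Matrix (Fin 2) (Fin 2) (WA K)
  | .e1 => single 0 0 1
  | .e2 => single 1 1 1
  | .al => single 0 0 (wd K [0])
  | .be => single 0 1 (wd K [1])
  | .ga => single 1 0 (wd K [2])
  | .et => single 1 1 (wd K [3])

noncomputable def rho : FreeAlgebra K Gen →ₐ[K] Matrix (Fin 2) (Fin 2) (WA K) :=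
  FreeAlgebra.lift K (gm K)

theorem rho_gen (g : Gen) : rho K (gen K g) = gm K g := by simp [rho, gen]

theorem single_pow_mul (i j : Fin 2) (u v : List (Fin 4)) (n : ℕ) :
    (single i i (wd K u)) ^ n * single i j (wd K v) = single i j (wd K (pw u n ++ v)) := by
  induction n with
  | zero => simp [pw_zero]
  | succ n ih =>
    rw [pow_succ', mul_assoc, ih, Matrix.single_mul_single_same, wd_mul, pw_succ, List.append_assoc]

theorem single_pow (i : Fin 2) (u : List (Fin 4)) (n : ℕ) :
    (single i i (wd K u)) ^ (n + 1) = single i i (wd K (pw u n ++ u)) := by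
  rw [pow_succ, single_pow_mul]

theorem smm (i j l : Fin 2) (u v : List (Fin 4)) :
    single i j (wd K u) * single j l (wd K v) = single i l (wd K (u ++ v)) := by
  rw [Matrix.single_mul_single_same, wd_mul]

end

structure WF {K : Type} [Field K] (k s : ℕ) (a c : K) (f : List (Fin 4) → K) : Prop where
  cyc : ∀ u v, f (u ++ v) = f (v ++ u)
  r1 : ∀ w, f (w ++ [1, 3]) = f (w ++ (pw [0, 1, 2] (k - 1) ++ [0, 1]))
  r2 : ∀ w, f (w ++ [3, 2]) = f (w ++ (pw [2, 0, 1] (k - 1) ++ [2, 0]))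
  r3 : ∀ w, f (w ++ [0, 0]) = a * f (w ++ (pw [1, 2, 0] (k - 1) ++ [1, 2])) +
    c * f (w ++ (pw [1, 2, 0] (k - 1) ++ [1, 2, 0]))
  r4 : ∀ w, f (w ++ [2, 1]) = f (w ++ (pw [3] (s - 2) ++ [3]))
  r5 : ∀ w, f (w ++ [0, 0, 1]) = 0
  r6 : ∀ w, f (w ++ [2, 0, 0]) = 0

variable {K : Type} [Field K] {k s : ℕ} {a c : K}

theorem TT_rel {f : List (Fin 4) → K} (hf : WF k s a c f) (hk : 1 ≤ k) (hs : 3 ≤ s)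
    {x y : FreeAlgebra K Gen} (hxy : Rel K k s a c x y) (M : Matrix (Fin 2) (Fin 2) (WA K)) :
    TT f (M * rho K x) = TT f (M * rho K y) := by
  obtain ⟨k, rfl⟩ := Nat.exists_eq_add_of_le' hk
  obtain ⟨s, rfl⟩ := Nat.exists_eq_add_of_le' hs
  have e1 : s + 3 - 1 = s + 1 + 1 := by omega
  have e2 : s + 3 - 2 = s + 1 := by omega
  have h4 := hf.r4
  rw [e2] at h4
  cases hxy <;> simp only [map_mul, map_pow, map_add, map_smul, map_one, map_zero, rho_gen, gm, smm,
    Nat.add_sub_cancel, e1, single_pow_mul, single_pow, List.cons_append, List.nil_append]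
  case rel_beta_eta =>
    exact TT_congr f _ _ _ _ (fun w => by simpa only [wd_mul, ext_wd, Nat.add_sub_cancel] using hf.r1 w) M
  case rel_eta_gamma =>
    exact TT_congr f _ _ _ _ (fun w => by simpa only [wd_mul, ext_wd, Nat.add_sub_cancel] using hf.r2 w) M
  case rel_gamma_beta =>
    exact TT_congr f _ _ _ _ (fun w => by simpa only [wd_mul, ext_wd] using h4 w) M
  case rel_alpha_sq =>
    rw [Matrix.smul_single, Matrix.smul_single, ← Matrix.single_add]
    refine TT_congr f _ _ _ _ (fun w => ?_) M
    simp only [mul_add, mul_smul_comm, map_add, map_smul, wd_mul, ext_wd, smul_eq_mul]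
    exact hf.r3 w
  case rel_alpha_sq_beta =>
    rw [← Matrix.single_zero (0 : Fin 2) (1 : Fin 2)]
    refine TT_congr f _ _ _ _ (fun w => ?_) M
    simp only [mul_zero, map_zero, wd_mul, ext_wd]
    exact hf.r5 w
  case rel_gamma_alpha_sq =>
    rw [← Matrix.single_zero (1 : Fin 2) (0 : Fin 2)]
    refine TT_congr f _ _ _ _ (fun w => ?_) M
    simp only [mul_zero, map_zero, wd_mul, ext_wd]
    exact hf.r6 w
  case sum_idem =>
    congr 2
    ext i j
    fin_cases i <;> fin_cases j <;> simp [Matrix.single]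
  all_goals simp

theorem TT_Rel {f : List (Fin 4) → K} (hf : WF k s a c f) (hk : 1 ≤ k) (hs : 3 ≤ s)
    {x y : FreeAlgebra K Gen} (hxy : RingQuot.Rel (Rel K k s a c) x y) :
    ∀ M : Matrix (Fin 2) (Fin 2) (WA K), TT f (M * rho K x) = TT f (M * rho K y) := by
  induction hxy with
  | of h => exact TT_rel hf hk hs h
  | add_left _ ih => intro M; simp only [map_add, mul_add, ih M]
  | @mul_left a b c _ ih =>
    intro M
    rw [map_mul (rho K), map_mul (rho K), ← mul_assoc, ← mul_assoc, TT_comm f hf.cyc, TT_comm f hf.cyc _ (rho K c),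
      ← mul_assoc, ← mul_assoc, ih]
  | mul_right _ ih =>
    intro M
    rw [map_mul (rho K), map_mul (rho K), ← mul_assoc, ← mul_assoc, ih]

theorem exists_fun (T : FreeAlgebra K Gen →ₗ[K] K)
    (hT : ∀ x y, RingQuot.Rel (Rel K k s a c) x y → T x = T y) :
    ∃ φ : Aa K k s a c →ₗ[K] K, ∀ x, φ (RingQuot.mkAlgHom K (Rel K k s a c) x) = T x := by
  let φ0 : Aa K k s a c → K := fun z => Quot.lift T hT z.toQuot
  have h0 : ∀ x, φ0 (RingQuot.mkAlgHom K (Rel K k s a c) x) = T x := by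
    intro x
    simp [φ0, RingQuot.mkAlgHom_def, RingQuot.mkRingHom_def]
  have hsurj := RingQuot.mkAlgHom_surjective K (Rel K k s a c)
  refine ⟨{ toFun := φ0, map_add' := ?_, map_smul' := ?_ }, h0⟩
  · intro x y
    obtain ⟨x, rfl⟩ := hsurj x
    obtain ⟨y, rfl⟩ := hsurj y
    rw [← map_add, h0, h0, h0, map_add]
  · intro r x
    obtain ⟨x, rfl⟩ := hsurj x
    rw [← map_smul, h0, h0, map_smul]; rfl

theorem exists_trace {f : List (Fin 4) → K} (hf : WF k s a c f) (hk : 1 ≤ k) (hs : 3 ≤ s) :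
    ∃ φ : Aa K k s a c →ₗ[K] K, (∀ u v, φ (u * v) = φ (v * u)) ∧
      φ (E1 K k s a c) = f [] ∧ φ (E2 K k s a c) = f [] ∧ φ (Al K k s a c) = f [0] ∧
      (∀ n, φ ((Al K k s a c * Be K k s a c * Ga K k s a c) ^ (n + 1)) = f (pw [0, 1, 2] (n + 1))) ∧
      (∀ n, φ ((Et K k s a c) ^ (n + 1)) = f (pw [3] (n + 1))) := by
  obtain ⟨φ, hφ⟩ := exists_fun (k := k) (s := s) (a := a) (c := c)
    ((TT f) ∘ₗ (rho K).toLinearMap) (by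
      intro x y h
      simpa using TT_Rel hf hk hs h 1)
  have ts : ∀ (i : Fin 2) (w : List (Fin 4)), TT f (single i i (wd K w)) = f w := by
    intro i w
    have := TT_single f 1 i i (wd K w)
    simpa [ext_wd] using this
  have ts1 : ∀ (i : Fin 2), TT f (single i i 1) = f [] := fun i => ts i []
  refine ⟨φ, ?_, ?_, ?_, ?_, ?_, ?_⟩
  · intro u v
    obtain ⟨u, rfl⟩ := RingQuot.mkAlgHom_surjective K (Rel K k s a c) u
    obtain ⟨v, rfl⟩ := RingQuot.mkAlgHom_surjective K (Rel K k s a c) v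
    rw [← map_mul, ← map_mul, hφ, hφ]
    simpa using TT_comm f hf.cyc _ _
  · simp [E1, hφ, rho_gen, gm, ts1]
  · simp [E2, hφ, rho_gen, gm, ts1]
  · simp [Al, hφ, rho_gen, gm, ts]
  · intro n
    rw [Al, Be, Ga, ← map_mul, ← map_mul, ← map_pow, hφ]
    simp only [LinearMap.comp_apply, AlgHom.toLinearMap_apply, map_mul, map_pow, rho_gen, gm, smm,
      single_pow, ts, List.cons_append, List.nil_append, pw_succ_last]
  · intro n
    rw [Et, ← map_pow, hφ]
    simp only [LinearMap.comp_apply, AlgHom.toLinearMap_apply, map_mul, map_pow, rho_gen, gm, smm,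
      single_pow, ts, List.cons_append, List.nil_append, pw_succ_last]

theorem exists_vertex (hk : 1 ≤ k) (hs : 3 ≤ s) (p q : K) (hp : p * p = p) (hq : q * q = q)
    (hpq : p * q = 0) (hpq1 : p + q = 1) :
    ∃ φ : Aa K k s a c →ₐ[K] K,
      φ (E1 K k s a c) = p ∧ φ (E2 K k s a c) = q ∧ φ (Al K k s a c) = 0 ∧
      φ (Et K k s a c) = 0 := by
  let g : Gen → K := fun x => match x with
    | .e1 => p
    | .e2 => q
    | _ => 0
  have hg : ∀ x, FreeAlgebra.lift K g (gen K x) = g x := by intro x; simp [gen]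
  have hs1 : s - 1 ≠ 0 := by omega
  have hk1 : k ≠ 0 := by omega
  have hw : ∀ ⦃x y⦄, Rel K k s a c x y → FreeAlgebra.lift K g x = FreeAlgebra.lift K g y := by
    intro x y h
    cases h <;> simp [hg, g, hp, hq, hpq, hpq1, mul_comm q p, hs1, hk1]
  refine ⟨RingQuot.liftAlgHom K ⟨FreeAlgebra.lift K g, hw⟩, ?_, ?_, ?_, ?_⟩
  · rw [E1, RingQuot.liftAlgHom_mkAlgHom_apply, hg]
  · rw [E2, RingQuot.liftAlgHom_mkAlgHom_apply, hg]
  · rw [Al, RingQuot.liftAlgHom_mkAlgHom_apply, hg]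
  · rw [Et, RingQuot.liftAlgHom_mkAlgHom_apply, hg]

end QT
namespace QT

variable {K : Type} [Field K] {k s : ℕ} {a c : K}

/-- indicator of a cyclic word -/
noncomputable def dl (K : Type) [Field K] (L w : List (Fin 4)) : K :=
  if List.IsRotated w L then 1 else 0

theorem dl_cyc (L u v : List (Fin 4)) : dl K L (u ++ v) = dl K L (v ++ u) := by
  have : List.IsRotated (u ++ v) L ↔ List.IsRotated (v ++ u) L :=
    ⟨fun h => List.isRotated_append.trans h, fun h => List.isRotated_append.trans h⟩
  simp [dl, this]

theorem count_pw (x : Fin 4) (u : List (Fin 4)) (n : ℕ) : (pw u n).count x = n * u.count x := by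
  induction n with
  | zero => simp [pw_zero]
  | succ n ih => rw [pw_succ, List.count_append, ih]; ring

/-- letter counts -/
def SameC (u v : List (Fin 4)) : Prop :=
  (u.count 0 = v.count 0 ∧ u.count 1 = v.count 1) ∧ (u.count 2 = v.count 2 ∧ u.count 3 = v.count 3)

theorem rot_count {u v : List (Fin 4)} (h : List.IsRotated u v) : SameC u v :=
  ⟨⟨h.perm.count_eq _, h.perm.count_eq _⟩, ⟨h.perm.count_eq _, h.perm.count_eq _⟩⟩

theorem perm_of_sameC {u v : List (Fin 4)} (h : SameC u v) : u.Perm v := by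
  rw [List.perm_iff_count]
  obtain ⟨⟨h0, h1⟩, ⟨h2, h3⟩⟩ := h
  intro x
  fin_cases x
  · exact h0
  · exact h1
  · exact h2
  · exact h3

theorem dl_zero {L w : List (Fin 4)} (h : ¬ SameC w L) : dl K L w = 0 := by
  rw [dl, if_neg (fun hr => h (rot_count hr))]

theorem dl_zero' {L w : List (Fin 4)} (h : ¬ List.IsRotated w L) : dl K L w = 0 := by
  rw [dl, if_neg h]

theorem dl_one {L w : List (Fin 4)} (h : List.IsRotated w L) : dl K L w = 1 := by
  rw [dl, if_pos h]

theorem dl_sing {L w u : List (Fin 4)} (x : Fin 4) (hx : List.IsRotated ([x] ++ u) L)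
    (h : SameC (w ++ u) L → SameC w [x]) : dl K L (w ++ u) = if w = [x] then 1 else 0 := by
  split_ifs with hw
  · rw [hw]; exact dl_one hx
  · apply dl_zero
    intro hc
    exact hw (List.perm_singleton.1 (perm_of_sameC (h hc)))

theorem dl_nil {L w u : List (Fin 4)} (hx : List.IsRotated u L)
    (h : SameC (w ++ u) L → SameC w []) : dl K L (w ++ u) = if w = [] then 1 else 0 := by
  split_ifs with hw
  · rw [hw]; exact dl_one hx
  · apply dl_zero
    intro hc
    exact hw (List.perm_nil.1 (perm_of_sameC (h hc)))

/-- successor relation on the 3-cycle -/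
def nx (x y : Fin 4) : Prop := (x = 0 ∧ y = 1) ∨ (x = 1 ∧ y = 2) ∨ (x = 2 ∧ y = 0)

theorem chain_pw (n : ℕ) : List.IsChain nx (pw [0, 1, 2] n) := by
  have : List.IsChain nx (2 :: pw [0, 1, 2] n) := by
    induction n with
    | zero => simp [pw_zero]
    | succ n ih => rw [pw_succ]; simp [nx] ; simpa using ih
  exact this.tail

theorem pw_add (u : List (Fin 4)) (m n : ℕ) : pw u (m + n) = pw u m ++ pw u n := by
  induction m with
  | zero => simp [pw_zero]
  | succ m ih => rw [Nat.add_right_comm, pw_succ, pw_succ, ih, List.append_assoc]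

theorem rot_infix {u v : List (Fin 4)} (h : List.IsRotated u v) : u <:+: v ++ v := by
  obtain ⟨n, hn, rfl⟩ := List.isRotated_iff_mod.1 h
  rw [List.rotate_eq_drop_append_take hn]
  refine ⟨u.drop n, u.take n, ?_⟩
  simp only [List.append_assoc]
  rw [← List.append_assoc (List.take n u), List.take_append_drop]

theorem not_rot_pw {x y : Fin 4} (hxy : ¬ nx x y) (w t : List (Fin 4)) (n : ℕ) :
    ¬ List.IsRotated (w ++ ([x, y] ++ t)) (pw [0, 1, 2] n) := by
  intro h
  have h1 := rot_infix h
  rw [← pw_add] at h1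
  have h2 := (chain_pw (n + n)).infix h1
  have h3 : [x, y] <:+: w ++ ([x, y] ++ t) := ⟨w, t, by simp⟩
  have := h2.infix h3
  simp at this
  exact hxy this

theorem WF_dl_P (m : ℕ) (h1 : 1 ≤ m) (hm : m < k) : WF k s a c (dl K (pw [0, 1, 2] m)) := by
  have A := fun w => dl_zero' (K := K) (not_rot_pw (x := 0) (y := 0) (by simp [nx]) w [] m)
  have B := fun w => dl_zero' (K := K) (not_rot_pw (x := 2) (y := 1) (by simp [nx]) w [] m)
  have C := fun w => dl_zero' (K := K) (not_rot_pw (x := 0) (y := 0) (by simp [nx]) w [1] m)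
  have D := fun w => dl_zero' (K := K) (not_rot_pw (x := 0) (y := 0) (by simp [nx]) (w ++ [2]) [] m)
  simp only [List.append_nil, List.append_assoc, List.cons_append, List.nil_append] at A B C D
  refine ⟨dl_cyc _, fun w => ?_, fun w => ?_, fun w => ?_, fun w => ?_, C, D⟩
  · rw [dl_zero, dl_zero] <;> simp [SameC, count_pw] <;> omega
  · rw [dl_zero, dl_zero] <;> simp [SameC, count_pw] <;> omega
  · rw [A, dl_zero, dl_zero]
    · simp
    all_goals simp [SameC, count_pw]
    all_goals omega
  · rw [B, dl_zero]
    simp [SameC, count_pw]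

theorem WF_dl_H (hk : 1 ≤ k) (m : ℕ) (hm : m + 1 < s) : WF k s a c (dl K (pw [3] m)) := by
  refine ⟨dl_cyc _, fun w => ?_, fun w => ?_, fun w => ?_, fun w => ?_, fun w => ?_, fun w => ?_⟩
  · rw [dl_zero, dl_zero] <;> simp [SameC, count_pw]
  · rw [dl_zero, dl_zero] <;> simp [SameC, count_pw]
  · rw [dl_zero, dl_zero, dl_zero] <;> simp [SameC, count_pw]
  · rw [dl_zero, dl_zero] <;> simp [SameC, count_pw] <;> omega
  · rw [dl_zero]; simp [SameC, count_pw]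
  · rw [dl_zero]; simp [SameC, count_pw]

theorem WF_dl_a (hk : 1 ≤ k) (hs : 3 ≤ s) : WF k s a c (dl K [0]) := by
  refine ⟨dl_cyc _, fun w => ?_, fun w => ?_, fun w => ?_, fun w => ?_, fun w => ?_, fun w => ?_⟩
  · rw [dl_zero, dl_zero] <;> simp [SameC, count_pw]
  · rw [dl_zero, dl_zero] <;> simp [SameC, count_pw]
  · rw [dl_zero, dl_zero, dl_zero] <;> simp [SameC, count_pw]
  · rw [dl_zero, dl_zero] <;> simp [SameC, count_pw]
  · rw [dl_zero]; simp [SameC, count_pw]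
  · rw [dl_zero]; simp [SameC, count_pw]

theorem WF_s1 (hk : 1 ≤ k) (hs : 3 ≤ s) : WF k s a c (fun w => dl K (pw [3] (s - 1)) w +
    dl K [1, 2] w + (if k = 1 then a else 0) * dl K [0, 0] w) := by
  refine ⟨fun u v => ?_, fun w => ?_, fun w => ?_, fun w => ?_, fun w => ?_, fun w => ?_, fun w => ?_⟩
  · simp only [dl_cyc _ u v]
  · rw [dl_zero, dl_zero, dl_zero, dl_zero, dl_zero, dl_zero] <;> simp [SameC, count_pw]
  · rw [dl_zero, dl_zero, dl_zero, dl_zero, dl_zero, dl_zero] <;> simp [SameC, count_pw]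
  · rw [dl_zero (L := pw [3] (s - 1)) (w := w ++ [0, 0]), dl_zero (L := [1, 2]) (w := w ++ [0, 0]),
      dl_zero (L := pw [3] (s - 1)) (w := w ++ (pw [1, 2, 0] (k - 1) ++ [1, 2])),
      dl_zero (L := [0, 0]) (w := w ++ (pw [1, 2, 0] (k - 1) ++ [1, 2])),
      dl_zero (L := pw [3] (s - 1)) (w := w ++ (pw [1, 2, 0] (k - 1) ++ [1, 2, 0])),
      dl_zero (L := [1, 2]) (w := w ++ (pw [1, 2, 0] (k - 1) ++ [1, 2, 0])),
      dl_zero (L := [0, 0]) (w := w ++ (pw [1, 2, 0] (k - 1) ++ [1, 2, 0]))]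
    · rw [dl_nil (L := [0, 0]) (u := [0, 0]) (List.IsRotated.refl _) (by simp [SameC])]
      by_cases h : k = 1
      · subst h
        rw [dl_nil (L := [1, 2]) (by simp [pw_zero]; exact List.IsRotated.refl _) (by simp [SameC, count_pw])]
        simp
      · rw [dl_zero (L := [1, 2])]
        · simp [h]
        · simp [SameC, count_pw]
          omega
    all_goals simp [SameC, count_pw]
  · have e : s - 2 + 1 = s - 1 := by omega
    rw [← pw_succ_last, e]
    rw [dl_zero, dl_nil (L := [1, 2]) (u := [2, 1]) (by decide) (by simp [SameC]), dl_zero,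
      dl_nil (L := pw [3] (s - 1)) (List.IsRotated.refl _) (by simp [SameC, count_pw]), dl_zero, dl_zero]
    · simp
    all_goals simp [SameC, count_pw]
    all_goals omega
  · rw [dl_zero, dl_zero, dl_zero] <;> simp [SameC, count_pw]
  · rw [dl_zero, dl_zero, dl_zero] <;> simp [SameC, count_pw]

theorem WF_top (hk : 1 ≤ k) (hs : 3 ≤ s) : WF k s a c (fun w => dl K (pw [0, 1, 2] k) w +
    dl K (pw [3] s) w + dl K [1, 3, 2] w + a * dl K [0, 0, 0] w + c * dl K [0, 0] w) := by
  obtain ⟨k, rfl⟩ := Nat.exists_eq_add_of_le' hk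
  have A := fun w => dl_zero' (K := K) (not_rot_pw (x := 0) (y := 0) (by simp [nx]) w [] (k + 1))
  have B := fun w => dl_zero' (K := K) (not_rot_pw (x := 2) (y := 1) (by simp [nx]) w [] (k + 1))
  have C := fun w => dl_zero' (K := K) (not_rot_pw (x := 0) (y := 0) (by simp [nx]) w [1] (k + 1))
  have D := fun w => dl_zero' (K := K) (not_rot_pw (x := 0) (y := 0) (by simp [nx]) (w ++ [2]) [] (k + 1))
  simp only [List.append_nil, List.append_assoc, List.cons_append, List.nil_append] at A B C D
  have R1 : List.IsRotated ([2] ++ (pw [0, 1, 2] k ++ [0, 1])) (pw [0, 1, 2] (k + 1)) := by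
    refine List.isRotated_append.trans ?_
    rw [pw_succ_last]; simp; exact List.IsRotated.refl _
  have R3 : List.IsRotated ([0] ++ (pw [1, 2, 0] k ++ [1, 2])) (pw [0, 1, 2] (k + 1)) := by
    have := pw_shift [0] [1, 2] k
    simp only [List.cons_append, List.nil_append] at this
    rw [pw_succ_last, ← List.append_assoc]
    simp only [List.cons_append, List.nil_append]
    rw [← List.cons_append, ← this]; simp; exact List.IsRotated.refl _
  have R3' : List.IsRotated (pw [1, 2, 0] k ++ [1, 2, 0]) (pw [0, 1, 2] (k + 1)) := by
    refine List.IsRotated.trans ?_ R3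
    have := List.isRotated_append (l := pw [1, 2, 0] k ++ [1, 2]) (l' := [0])
    simpa using this
  have R2 : List.IsRotated ([1] ++ (pw [2, 0, 1] k ++ [2, 0])) (pw [0, 1, 2] (k + 1)) := by
    refine List.IsRotated.trans ?_ R3'
    have := pw_shift [1] [2, 0] k
    simp only [List.cons_append, List.nil_append] at this
    rw [← List.append_assoc]
    simp only [List.cons_append, List.nil_append]
    rw [← List.cons_append, ← this]; simp; exact List.IsRotated.refl _
  refine ⟨fun u v => ?_, fun w => ?_, fun w => ?_, fun w => ?_, fun w => ?_, fun w => ?_, fun w => ?_⟩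
  · simp only [dl_cyc _ u v]
  · simp only [Nat.add_sub_cancel]
    rw [dl_sing (L := [1, 3, 2]) (u := [1, 3]) 2 (by decide) (by simp [SameC]),
      dl_sing (L := pw [0, 1, 2] (k + 1)) 2 R1 (by simp [SameC, count_pw]; omega),
      dl_zero, dl_zero, dl_zero, dl_zero, dl_zero, dl_zero, dl_zero, dl_zero]
    · simp
    all_goals simp [SameC, count_pw]
  · simp only [Nat.add_sub_cancel]
    rw [dl_sing (L := [1, 3, 2]) (u := [3, 2]) 1 (by decide) (by simp [SameC]),
      dl_sing (L := pw [0, 1, 2] (k + 1)) 1 R2 (by simp [SameC, count_pw]; omega),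
      dl_zero, dl_zero, dl_zero, dl_zero, dl_zero, dl_zero, dl_zero, dl_zero]
    · simp
    all_goals simp [SameC, count_pw]
  · simp only [Nat.add_sub_cancel]
    have Z : dl K [1, 3, 2] (w ++ (pw [1, 2, 0] k ++ [1, 2])) = 0 := by
      apply dl_zero'
      intro hr
      have hc := rot_count hr
      simp [SameC, count_pw] at hc
      have hk0 : k = 0 := by omega
      have : w = [3] := by
        refine List.perm_singleton.1 (perm_of_sameC ?_)
        simp [SameC]
        omega
      subst this
      subst hk0
      revert hr
      decide
    rw [A, Z, dl_sing (L := [0, 0, 0]) (u := [0, 0]) 0 (by decide) (by simp [SameC]),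
      dl_nil (L := [0, 0]) (u := [0, 0]) (by decide) (by simp [SameC]),
      dl_sing (L := pw [0, 1, 2] (k + 1)) 0 R3 (by simp [SameC, count_pw]; omega),
      dl_nil (L := pw [0, 1, 2] (k + 1)) R3' (by simp [SameC, count_pw]),
      dl_zero, dl_zero, dl_zero, dl_zero, dl_zero, dl_zero, dl_zero, dl_zero, dl_zero]
    · simp
    all_goals simp [SameC, count_pw]
  · have e : s - 2 + 1 = s - 1 := by omega
    have e' : s - 1 + 1 = s := by omega
    have R4 : List.IsRotated ([3] ++ pw [3] (s - 1)) (pw [3] s) := by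
      rw [← pw_succ, e']
    rw [← pw_succ_last, e]
    rw [B, dl_zero, dl_sing (L := [1, 3, 2]) (u := [2, 1]) 3 (by decide) (by simp [SameC]),
      dl_sing (L := pw [3] s) 3 R4 (by simp [SameC, count_pw] ; try omega),
      dl_zero, dl_zero, dl_zero, dl_zero, dl_zero, dl_zero]
    · simp
    all_goals simp [SameC, count_pw]
    all_goals omega
  · rw [C, dl_zero, dl_zero, dl_zero, dl_zero] <;> simp [SameC, count_pw]
  · rw [D, dl_zero, dl_zero, dl_zero, dl_zero] <;> simp [SameC, count_pw]

end QT
namespace QT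

variable {K : Type} [Field K] {k s : ℕ} {a c : K}

theorem dual_ex (hk : 1 ≤ k) (hs : 3 ≤ s) (i : CIdx k s) :
    ∃ φ : Aa K k s a c →ₗ[K] K, (∀ u v, φ (u * v) = φ (v * u)) ∧
      φ (cVec K k s a c i) = 1 ∧ ∀ j, j ≠ i → φ (cVec K k s a c j) = 0 := by
  rcases i with (_ | (_ | _)) | (m | t)
  · obtain ⟨φ, h1, h2, h3, h4⟩ := exists_vertex (K := K) (k := k) (s := s) (a := a) (c := c)
      hk hs 1 0 (by simp) (by simp) (by simp) (by simp)
    refine ⟨φ.toLinearMap, fun u v => by simp [mul_comm], by simpa [cVec] using h1, ?_⟩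
    rintro ((_ | (_ | _)) | (m | t)) hj
    all_goals simp_all [cVec]
  · obtain ⟨φ, h1, h2, h3, h4⟩ := exists_vertex (K := K) (k := k) (s := s) (a := a) (c := c)
      hk hs 0 1 (by simp) (by simp) (by simp) (by simp)
    refine ⟨φ.toLinearMap, fun u v => by simp [mul_comm], by simpa [cVec] using h2, ?_⟩
    rintro ((_ | (_ | _)) | (m | t)) hj
    all_goals simp_all [cVec]
  · obtain ⟨φ, h0, h1, h2, h3, h4, h5⟩ := exists_trace (WF_dl_a (K := K) (a := a) (c := c) hk hs) hk hs
    refine ⟨φ, h0, ?_, ?_⟩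
    · simp only [cVec, h3]; exact dl_one (List.IsRotated.refl _)
    · rintro ((_ | (_ | _)) | (m | t)) hj
      · simp only [cVec, h1]; apply dl_zero; simp [SameC]
      · simp only [cVec, h2]; apply dl_zero; simp [SameC]
      · simp at hj
      · simp only [cVec, h4]; apply dl_zero; simp [SameC, count_pw]
      · simp only [cVec, h5]; apply dl_zero; simp [SameC, count_pw]
  · obtain ⟨m, hm⟩ := m
    by_cases hmk : m + 1 < k
    · obtain ⟨φ, h0, h1, h2, h3, h4, h5⟩ := exists_trace
        (WF_dl_P (K := K) (s := s) (a := a) (c := c) (m + 1) (by omega) hmk) hk hs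
      refine ⟨φ, h0, ?_, ?_⟩
      · simp only [cVec, h4]; exact dl_one (List.IsRotated.refl _)
      · rintro ((_ | (_ | _)) | (n | t)) hj
        · simp only [cVec, h1]; apply dl_zero; simp [SameC, count_pw]
        · simp only [cVec, h2]; apply dl_zero; simp [SameC, count_pw]
        · simp only [cVec, h3]; apply dl_zero; simp [SameC, count_pw]
        · have : (n : ℕ) ≠ m := fun h => hj (by simp [← h])
          simp only [cVec, h4]; apply dl_zero; simp [SameC, count_pw]; omega
        · simp only [cVec, h5]; apply dl_zero; simp [SameC, count_pw]
    · obtain rfl : k = m + 1 := by omega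
      obtain ⟨φ, h0, h1, h2, h3, h4, h5⟩ := exists_trace
        (WF_top (K := K) (a := a) (c := c) hk hs) hk hs
      refine ⟨φ, h0, ?_, ?_⟩
      · simp only [cVec, h4]
        rw [dl_one (List.IsRotated.refl _), dl_zero, dl_zero, dl_zero, dl_zero]
        · simp
        all_goals simp [SameC, count_pw]
      · rintro ((_ | (_ | _)) | (n | t)) hj
        · simp only [cVec, h1]
          rw [dl_zero, dl_zero, dl_zero, dl_zero, dl_zero]
          · simp
          all_goals simp [SameC, count_pw]
          all_goals omega
        · simp only [cVec, h2]
          rw [dl_zero, dl_zero, dl_zero, dl_zero, dl_zero]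
          · simp
          all_goals simp [SameC, count_pw]
          all_goals omega
        · simp only [cVec, h3]
          rw [dl_zero, dl_zero, dl_zero, dl_zero, dl_zero]
          · simp
          all_goals simp [SameC, count_pw]
        · have : (n : ℕ) ≠ m := fun h => hj (by simp [← h])
          simp only [cVec, h4]
          rw [dl_zero, dl_zero, dl_zero, dl_zero, dl_zero]
          · simp
          all_goals simp [SameC, count_pw]
          all_goals omega
        · have := t.2
          simp only [cVec, h5]
          rw [dl_zero, dl_zero, dl_zero, dl_zero, dl_zero]
          · simp
          all_goals simp [SameC, count_pw]
          all_goals omega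
  · obtain ⟨m, hm⟩ := t
    by_cases hmk : m + 1 < s - 1
    · obtain ⟨φ, h0, h1, h2, h3, h4, h5⟩ := exists_trace
        (WF_dl_H (K := K) (s := s) (a := a) (c := c) hk (m + 1) (by omega)) hk hs
      refine ⟨φ, h0, ?_, ?_⟩
      · simp only [cVec, h5]; exact dl_one (List.IsRotated.refl _)
      · rintro ((_ | (_ | _)) | (n | t)) hj
        · simp only [cVec, h1]; apply dl_zero; simp [SameC, count_pw]
        · simp only [cVec, h2]; apply dl_zero; simp [SameC, count_pw]
        · simp only [cVec, h3]; apply dl_zero; simp [SameC, count_pw]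
        · simp only [cVec, h4]; apply dl_zero; simp [SameC, count_pw]
        · have : (t : ℕ) ≠ m := fun h => hj (by simp [← h])
          simp only [cVec, h5]; apply dl_zero; simp [SameC, count_pw]; omega
    · have hm1 : s - 1 = m + 1 := by omega
      obtain ⟨φ, h0, h1, h2, h3, h4, h5⟩ := exists_trace
        (WF_s1 (K := K) (a := a) (c := c) hk hs) hk hs
      rw [hm1] at h1 h2 h3 h4 h5
      refine ⟨φ, h0, ?_, ?_⟩
      · simp only [cVec, h5]
        rw [dl_one (List.IsRotated.refl _), dl_zero, dl_zero]
        · simp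
        all_goals simp [SameC, count_pw]
      · rintro ((_ | (_ | _)) | (n | t)) hj
        · simp only [cVec, h1]
          rw [dl_zero, dl_zero, dl_zero]
          · simp
          all_goals simp [SameC, count_pw]
        · simp only [cVec, h2]
          rw [dl_zero, dl_zero, dl_zero]
          · simp
          all_goals simp [SameC, count_pw]
        · simp only [cVec, h3]
          rw [dl_zero, dl_zero, dl_zero]
          · simp
          all_goals simp [SameC, count_pw]
        · simp only [cVec, h4]
          rw [dl_zero, dl_zero, dl_zero]
          · simp
          all_goals simp [SameC, count_pw]
        · have : (t : ℕ) ≠ m := fun h => hj (by simp [← h])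
          simp only [cVec, h5]
          rw [dl_zero, dl_zero, dl_zero]
          · simp
          all_goals simp [SameC, count_pw]
          all_goals omega

theorem c_li (hk : 1 ≤ k) (hs : 3 ≤ s) : LinearIndependent K
    (fun i : CIdx k s => Submodule.Quotient.mk (p := comm K k s a c) (cVec K k s a c i)) := by
  choose φ h0 h1 h2 using fun i => dual_ex (K := K) (a := a) (c := c) hk hs i
  have hle : ∀ i, comm K k s a c ≤ LinearMap.ker (φ i) := by
    intro i
    refine Submodule.span_le.2 ?_
    rintro _ ⟨u, v, rfl⟩
    simp [h0 i u v]
  refine LinearIndependent.of_pairwise_dual_eq_zero_one _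
    (fun i => (comm K k s a c).liftQ (φ i) (hle i)) ?_ ?_
  · intro i j hij
    exact h2 i j (Ne.symm hij)
  · intro i
    exact h1 i

theorem c_span (hk : 1 ≤ k) (hs : 3 ≤ s) : Submodule.span K (Set.range
    (fun i : CIdx k s => Submodule.Quotient.mk (p := comm K k s a c) (cVec K k s a c i))) = ⊤ := by
  set T := Submodule.span K (Set.range
    (fun i : CIdx k s => Submodule.Quotient.mk (p := comm K k s a c) (cVec K k s a c i))) with hT
  have hc : ∀ i, cVec K k s a c i ∈ T.comap (comm K k s a c).mkQ :=
    fun i => Submodule.subset_span ⟨i, rfl⟩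
  have hS : cm K (Aa K k s a c) ≤ T.comap (comm K k s a c).mkQ := by
    intro x hx
    have : (comm K k s a c).mkQ x = 0 := (Submodule.Quotient.mk_eq_zero _).2 hx
    rw [Submodule.mem_comap, this]
    exact T.zero_mem
  have htop : T.comap (comm K k s a c).mkQ = ⊤ := by
    rw [eq_top_iff, ← fam_top K k s a c hk hs]
    refine Submodule.span_le.2 ?_
    intro x hx
    refine (presA K k s a c).fam_S hk hs _ hS (hc (.inl (.inl ()))) (hc (.inl (.inr (.inl ()))))
      (hc (.inl (.inr (.inr ())))) ?_ ?_ hx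
    · intro m hm
      have := hc (.inr (.inl ⟨m, by omega⟩))
      simpa only [cVec, mul_assoc] using this
    · intro t ht
      exact hc (.inr (.inr ⟨t, by omega⟩))
  rw [eq_top_iff]
  intro y _
  obtain ⟨x, rfl⟩ := Submodule.mkQ_surjective _ y
  have : x ∈ T.comap (comm K k s a c).mkQ := by rw [htop]; trivial
  exact this

end QT
open QT in
/-- The images of e₁, e₂, α, (αβγ)^m for 1 ≤ m ≤ k, and η^t for
1 ≤ t ≤ s−1 form a K-basis of the commutator quotient A^{k,s}(a,c)/[A,A]; in
particular dim_K A/[A,A] = k + s + 2.  Moreover η^s − (αβγ)^k ∈ [A,A],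
(αβγ)^m − (βγα)^m ∈ [A,A] and (αβγ)^m − (γαβ)^m ∈ [A,A] for all m ≥ 1,
α(βγα)^n ∈ [A,A] for all n ≥ 1, and (βγα)^m βγ ∈ [A,A] for all m ≥ 1. -/
theorem statement2 (K : Type) [Field K] (k s : ℕ) (hk : 1 ≤ k) (hs : 3 ≤ s)
    (a c : K) (ha : a ≠ 0) :
    (LinearIndependent K
        (fun i : CIdx k s => Submodule.Quotient.mk (p := comm K k s a c) (cVec K k s a c i)) ∧
      Submodule.span K
        (Set.range
          (fun i : CIdx k s => Submodule.Quotient.mk (p := comm K k s a c) (cVec K k s a c i))) = ⊤ ∧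
      Module.finrank K (Aa K k s a c ⧸ comm K k s a c) = k + s + 2) ∧
    (Et K k s a c) ^ s - (Al K k s a c * Be K k s a c * Ga K k s a c) ^ k ∈ comm K k s a c ∧
    (∀ m : ℕ, 1 ≤ m →
      (Al K k s a c * Be K k s a c * Ga K k s a c) ^ m -
        (Be K k s a c * Ga K k s a c * Al K k s a c) ^ m ∈ comm K k s a c) ∧
    (∀ m : ℕ, 1 ≤ m →
      (Al K k s a c * Be K k s a c * Ga K k s a c) ^ m -
        (Ga K k s a c * Al K k s a c * Be K k s a c) ^ m ∈ comm K k s a c) ∧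
    (∀ n : ℕ, 1 ≤ n →
      Al K k s a c * (Be K k s a c * Ga K k s a c * Al K k s a c) ^ n ∈ comm K k s a c) ∧
    (∀ m : ℕ, 1 ≤ m →
      (Be K k s a c * Ga K k s a c * Al K k s a c) ^ m * (Be K k s a c * Ga K k s a c)
        ∈ comm K k s a c) := by
  refine ⟨⟨c_li hk hs, c_span hk hs, ?_⟩, ?_, ?_, ?_, ?_, ?_⟩
  · rw [Module.finrank_eq_card_basis (Module.Basis.mk (c_li hk hs) (c_span hk hs).ge)]
    simp
    omega
  · obtain ⟨j, rfl⟩ := Nat.exists_eq_add_of_le' hk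
    have h1 := (presA K (j + 1) s a c).etas hs hk
    have h2 := Pres.cm_PQ (K := K) (α := Al K (j + 1) s a c) (β := Be K (j + 1) s a c)
      (γ := Ga K (j + 1) s a c) j
    rw [← h1] at h2
    have h3 := Submodule.neg_mem _ h2
    rw [neg_sub, ← mul_assoc] at h3
    exact h3
  · intro m hm
    obtain ⟨j, rfl⟩ := Nat.exists_eq_add_of_le' hm
    have := Pres.cm_PR (K := K) (α := Al K k s a c) (β := Be K k s a c) (γ := Ga K k s a c) j
    simp only [← mul_assoc] at this
    exact this
  · intro m hm
    obtain ⟨j, rfl⟩ := Nat.exists_eq_add_of_le' hm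
    have := Pres.cm_PQ (K := K) (α := Al K k s a c) (β := Be K k s a c) (γ := Ga K k s a c) j
    simp only [← mul_assoc] at this
    exact this
  · intro m hm
    obtain ⟨j, rfl⟩ := Nat.exists_eq_add_of_le' hm
    have := (presA K k s a c).cm_aR j
    rw [← mul_assoc (Be K k s a c)] at this
    exact this
  · intro m hm
    obtain ⟨j, rfl⟩ := Nat.exists_eq_add_of_le' hm
    have := (presA K k s a c).cm_Rb hs j
    rw [← mul_assoc (Be K k s a c) (Ga K k s a c) (Al K k s a c)] at this
    exact this
end

section
/- If K is algebraically closed and c ≠ 0, then there exists a nonzero a'' ∈ K with an isomorphism of K-algebras A^{k,s}(a,c) ≅ A^{k,s}(a'',1). -/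
namespace QT
open Gen

/-- scaled generators -/
noncomputable def scGen (K : Type) [Field K] (k s : ℕ) (a c : K) (x p w : K) :
    Gen → Aa K k s a c
  | e1 => E1 K k s a c
  | e2 => E2 K k s a c
  | al => x • Al K k s a c
  | be => Be K k s a c
  | ga => p • Ga K k s a c
  | et => w • Et K k s a c

theorem scGen_rel (K : Type) [Field K] (k s : ℕ) (a c a' c' : K) (x p w : K)
    (hw : w = x ^ (k - 1) * p ^ (k - 1) * x) (hp : p = w ^ (s - 1))
    (h1 : x * x * a' = a * (p ^ (k - 1) * x ^ (k - 1) * p))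
    (h2 : x * x * c' = c * (p ^ k * x ^ k))
    {u v : FreeAlgebra K Gen} (h : Rel K k s a c u v) :
    FreeAlgebra.lift K (scGen K k s a' c' x p w) u =
      FreeAlgebra.lift K (scGen K k s a' c' x p w) v := by
  have key : ∀ {u v : FreeAlgebra K Gen}, Rel K k s a' c' u v →
      RingQuot.mkAlgHom K (Rel K k s a' c') u = RingQuot.mkAlgHom K (Rel K k s a' c') v :=
    fun h => RingQuot.mkAlgHom_rel K h
  cases h with
  | idem1 => simpa [gen, scGen, E1] using key Rel.idem1
  | idem2 => simpa [gen, scGen, E2] using key Rel.idem2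
  | orth12 => simpa [gen, scGen, E1, E2] using key Rel.orth12
  | orth21 => simpa [gen, scGen, E1, E2] using key Rel.orth21
  | sum_idem => simpa [gen, scGen, E1, E2] using key Rel.sum_idem
  | al_left =>
    have := key Rel.al_left
    simp only [map_mul] at this
    simp [gen, scGen, E1, Al] at this ⊢; rw [this]
  | al_right =>
    have := key Rel.al_right
    simp only [map_mul] at this
    simp [gen, scGen, E1, Al] at this ⊢; rw [this]
  | be_left => simpa [gen, scGen, E1, Be] using key Rel.be_left
  | be_right => simpa [gen, scGen, E2, Be] using key Rel.be_right
  | ga_left =>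
    have := key Rel.ga_left
    simp [gen, scGen, E2, Ga] at this ⊢; rw [this]
  | ga_right =>
    have := key Rel.ga_right
    simp [gen, scGen, E1, Ga] at this ⊢; rw [this]
  | et_left =>
    have := key Rel.et_left
    simp [gen, scGen, E2, Et] at this ⊢; rw [this]
  | et_right =>
    have := key Rel.et_right
    simp [gen, scGen, E2, Et] at this ⊢; rw [this]
  | rel_beta_eta =>
    have := key Rel.rel_beta_eta
    simp only [map_mul, map_pow] at this
    simp only [gen, map_mul, map_pow, FreeAlgebra.lift_ι_apply, scGen, Al, Be, Ga, Et,
      smul_mul_assoc, mul_smul_comm, smul_pow, smul_smul] at this ⊢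
    rw [this]; congr 1; rw [hw]; ring
  | rel_eta_gamma =>
    have := key Rel.rel_eta_gamma
    simp only [map_mul, map_pow] at this
    simp only [gen, map_mul, map_pow, FreeAlgebra.lift_ι_apply, scGen, Al, Be, Ga, Et,
      smul_mul_assoc, mul_smul_comm, smul_pow, smul_smul] at this ⊢
    rw [this]; congr 1; rw [hw]; ring
  | rel_alpha_sq =>
    have := key Rel.rel_alpha_sq
    simp only [map_mul, map_pow, map_add, map_smul] at this
    simp only [gen, map_mul, map_pow, map_add, map_smul, FreeAlgebra.lift_ι_apply, scGen,
      Al, Be, Ga, Et, smul_mul_assoc, mul_smul_comm, smul_pow, smul_smul] at this ⊢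
    rw [this, smul_add, smul_smul, smul_smul, h1, h2]
    congr 2 <;> ring
  | rel_gamma_beta =>
    have := key Rel.rel_gamma_beta
    simp only [map_mul, map_pow] at this
    simp only [gen, map_mul, map_pow, FreeAlgebra.lift_ι_apply, scGen, Al, Be, Ga, Et,
      smul_mul_assoc, mul_smul_comm, smul_pow, smul_smul] at this ⊢
    rw [this, ← hp]
  | rel_alpha_sq_beta =>
    have := key Rel.rel_alpha_sq_beta
    simp only [map_mul, map_zero] at this
    simp only [gen, map_mul, map_zero, FreeAlgebra.lift_ι_apply, scGen, Al, Be, Ga, Et,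
      smul_mul_assoc, mul_smul_comm, smul_smul] at this ⊢
    rw [this, smul_zero]
  | rel_gamma_alpha_sq =>
    have := key Rel.rel_gamma_alpha_sq
    simp only [map_mul, map_zero] at this
    simp only [gen, map_mul, map_zero, FreeAlgebra.lift_ι_apply, scGen, Al, Be, Ga, Et,
      smul_mul_assoc, mul_smul_comm, smul_smul] at this ⊢
    rw [this, smul_zero]

theorem exists_hom (K : Type) [Field K] (k s : ℕ) (a c a' c' : K) (x p w : K)
    (hw : w = x ^ (k - 1) * p ^ (k - 1) * x) (hp : p = w ^ (s - 1))
    (h1 : x * x * a' = a * (p ^ (k - 1) * x ^ (k - 1) * p))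
    (h2 : x * x * c' = c * (p ^ k * x ^ k)) :
    ∃ f : Aa K k s a c →ₐ[K] Aa K k s a' c', ∀ g : Gen,
      f (RingQuot.mkAlgHom K (Rel K k s a c) (FreeAlgebra.ι K g)) =
        scGen K k s a' c' x p w g := by
  refine ⟨RingQuot.liftAlgHom K ⟨FreeAlgebra.lift K (scGen K k s a' c' x p w),
    fun _ _ h => scGen_rel K k s a c a' c' x p w hw hp h1 h2 h⟩, fun g => ?_⟩
  simp

theorem scale_iso (K : Type) [Field K] (k s : ℕ) (a c a' c' : K) (x p w : K)
    (hx : x ≠ 0) (hp0 : p ≠ 0) (hw0 : w ≠ 0)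
    (hw : w = x ^ (k - 1) * p ^ (k - 1) * x) (hp : p = w ^ (s - 1))
    (h1 : x * x * a' = a * (p ^ (k - 1) * x ^ (k - 1) * p))
    (h2 : x * x * c' = c * (p ^ k * x ^ k)) :
    Nonempty (Aa K k s a c ≃ₐ[K] Aa K k s a' c') := by
  obtain ⟨f, hf⟩ := exists_hom K k s a c a' c' x p w hw hp h1 h2
  obtain ⟨g, hg⟩ := exists_hom K k s a' c' a c x⁻¹ p⁻¹ w⁻¹
    (by rw [hw]; simp only [mul_inv, inv_pow]) (by rw [inv_pow, ← hp])
    (by simp only [inv_pow]; field_simp; linear_combination -h1)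
    (by simp only [inv_pow]; field_simp; linear_combination -h2)
  refine ⟨AlgEquiv.ofAlgHom f g ?_ ?_⟩
  · apply RingQuot.ringQuot_ext'
    ext i
    cases i <;> simp [hg, scGen, E1, E2, Al, Be, Ga, Et, gen, hf, smul_smul, hx, hp0, hw0]
  · apply RingQuot.ringQuot_ext'
    ext i
    cases i <;> simp [hg, scGen, E1, E2, Al, Be, Ga, Et, gen, hf, smul_smul, hx, hp0, hw0]

end QT

open QT in
/-- If K is algebraically closed and c ≠ 0, then there exists a nonzero
a'' ∈ K with an isomorphism of K-algebras A^{k,s}(a,c) ≅ A^{k,s}(a'',1). -/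
theorem statement6 (K : Type) [Field K] [IsAlgClosed K] (k s : ℕ)
    (hk : 1 ≤ k) (hs : 3 ≤ s) (a c : K) (ha : a ≠ 0) (hc : c ≠ 0) :
    ∃ a'' : K, a'' ≠ 0 ∧ Nonempty (Aa K k s a c ≃ₐ[K] Aa K k s a'' 1) := by
  obtain ⟨m, rfl⟩ := Nat.exists_eq_add_of_le' hk
  obtain ⟨n, rfl⟩ := Nat.exists_eq_add_of_le' hs
  obtain ⟨t, ht⟩ := IsAlgClosed.exists_pow_nat_eq c⁻¹
    (n := 3 * n * m + 7 * m + n + 1) (by omega)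
  have ht0 : t ≠ 0 := by
    rintro rfl
    rw [zero_pow (by omega)] at ht
    exact inv_ne_zero hc ht.symm
  have hc' : c = t ^ (-(3 * n * m + 7 * m + n + 1 : ℤ)) := by
    rw [zpow_neg, ← inv_inv c, ← ht]
    norm_cast
  obtain ⟨x, hx⟩ : ∃ x, x = t ^ (1 - (n + 2) * m : ℤ) := ⟨_, rfl⟩
  obtain ⟨p, hp⟩ : ∃ p, p = t ^ ((m + 1) * (n + 2) : ℤ) := ⟨_, rfl⟩
  obtain ⟨w, hw⟩ : ∃ w, w = t ^ (m + 1 : ℤ) := ⟨_, rfl⟩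
  have hx0 : x ≠ 0 := hx ▸ zpow_ne_zero _ ht0
  have hp0 : p ≠ 0 := hp ▸ zpow_ne_zero _ ht0
  have hw0 : w ≠ 0 := hw ▸ zpow_ne_zero _ ht0
  refine ⟨a * (p ^ m * x ^ m * p) / (x * x), by positivity, ?_⟩
  refine scale_iso K (m + 1) (n + 3) a c _ 1 x p w hx0 hp0 hw0 ?_ ?_ ?_ ?_
  · simp only [Nat.add_sub_cancel]
    rw [hw, hx, hp]
    simp only [← zpow_natCast, ← zpow_mul, ← zpow_add₀ ht0]
    congr 1; push_cast; ring
  · rw [hw, hp, show n + 3 - 1 = n + 2 by omega]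
    simp only [← zpow_natCast, ← zpow_mul, ← zpow_add₀ ht0]
    congr 1
  · simp only [Nat.add_sub_cancel]
    field_simp
  · rw [mul_one, hc', hx, hp]
    simp only [← zpow_natCast, ← zpow_mul, ← zpow_add₀ ht0]
    congr 1; push_cast; ring
end
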